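/- arXiv:gr-qc/9902044 — 14 statements merged into one kernel-verified Lean document; each statement's English description precedes it below -/
import Mathlib

section
/- Suppose in addition that the Legendre map in the top velocities is globally invertible: there is a smooth map V = (V_k) sending (q, π) with q = (q_{k,γ})_{k=1..K, 0≤γ≤α_k−1} and π = (π_k) ∈ ℝ^K to V(q,π) ∈ ℝ^K, such that (∂L/∂x_k^{(α_k)})(q, V(q,π)) = π_k for all (q,π) and V(q, ((∂L/∂x_k^{(α_k)})(q,v))_k) = v for all (q,v). Define the Ostrogradsky Hamiltonian H(q,p) := Σ_k V_k(q, (p_{l,α_l−1})_l) · p_{k,α_k−1} − L(q, V(q,(p_{l,α_l−1})_l)) + Σ_k Σ_{β=1}^{α_k−1} q_{k,β} p_{k,β−1}. Then a sufficiently differentiable curve x : ℝ → ℝ^K satisfies the Euler–Lagrange equations E_k = 0 for all k if and only if the phase-space curve defined by q_{k,γ}(t) := x_k^{(γ)}(t) together with the Ostrogradsky momenta p_{k,γ}(t) satisfies Hamilton's equations dq_{k,γ}/dt = ∂H/∂p_{k,γ} and dp_{k,γ}/dt = −∂H/∂q_{k,γ} for all k and all 0 ≤ γ ≤ α_k − 1.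 -/
noncomputable section

/-- The partial derivative `∂L/∂x_k^{(σ)}` of the higher-order Lagrangian `L`
at the jet point `a`, i.e. the directional derivative of `L` in the direction of
the jet coordinate `x_k^{(σ)}`. -/
def jetPD {K : ℕ} {α : Fin K → ℕ}
    (L : (∀ k : Fin K, Fin (α k + 1) → ℝ) → ℝ)
    (a : ∀ k : Fin K, Fin (α k + 1) → ℝ) (k : Fin K) (σ : Fin (α k + 1)) : ℝ :=
  fderiv ℝ L a (Pi.single k (Pi.single σ 1))

/-- The jet `J(t) = (x_k^{(γ)}(t))_{k, 0 ≤ γ ≤ α_k}` of a curve `x`. -/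
def jetOf {K : ℕ} (α : Fin K → ℕ) (x : ℝ → Fin K → ℝ) (t : ℝ) :
    ∀ k : Fin K, Fin (α k + 1) → ℝ :=
  fun k γ => iteratedDeriv (γ : ℕ) (fun s => x s k) t

/-- The truncated jet `(x_k^{(γ)}(t))_{k, 0 ≤ γ ≤ α_k − 1}` of a curve `x`. -/
def tjetOf {K : ℕ} (α : Fin K → ℕ) (x : ℝ → Fin K → ℝ) (t : ℝ) :
    ∀ k : Fin K, Fin (α k) → ℝ :=
  fun k γ => iteratedDeriv (γ : ℕ) (fun s => x s k) t

/-- The `k`-th Euler–Lagrange expression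
`E_k(t) = Σ_{σ=0}^{α_k} (−1)^σ (d/dt)^σ [(∂L/∂x_k^{(σ)}) ∘ J](t)` along the curve `x`. -/
def eulerLagrange {K : ℕ} {α : Fin K → ℕ}
    (L : (∀ k : Fin K, Fin (α k + 1) → ℝ) → ℝ)
    (x : ℝ → Fin K → ℝ) (k : Fin K) (t : ℝ) : ℝ :=
  ∑ σ : Fin (α k + 1),
    (-1 : ℝ) ^ (σ : ℕ) * iteratedDeriv (σ : ℕ) (fun s => jetPD L (jetOf α x s) k σ) t

/-- Packing a configuration point `q = (q_{k,γ})_{0 ≤ γ ≤ α_k − 1}` and top velocities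
`v = (v_k)` into a jet point. -/
def packQV {K : ℕ} (α : Fin K → ℕ) (q : ∀ k : Fin K, Fin (α k) → ℝ)
    (v : Fin K → ℝ) : ∀ k : Fin K, Fin (α k + 1) → ℝ :=
  fun k γ => if h : (γ : ℕ) < α k then q k ⟨γ, h⟩ else v k

/-- The Ostrogradsky Hamiltonian
`H(q,p) := Σ_k V_k(q, (p_{l,α_l−1})_l) p_{k,α_k−1} − L(q, V(q,(p_{l,α_l−1})_l))
  + Σ_k Σ_{β=1}^{α_k−1} q_{k,β} p_{k,β−1}`. -/
def ostroHam {K : ℕ} (α : Fin K → ℕ) (hα : ∀ k, 1 ≤ α k)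
    (L : (∀ k : Fin K, Fin (α k + 1) → ℝ) → ℝ)
    (V : (∀ k : Fin K, Fin (α k) → ℝ) → (Fin K → ℝ) → Fin K → ℝ)
    (qp : (∀ k : Fin K, Fin (α k) → ℝ) × (∀ k : Fin K, Fin (α k) → ℝ)) : ℝ :=
  (∑ k : Fin K,
      V qp.1 (fun l => qp.2 l ⟨α l - 1, Nat.sub_lt (hα l) Nat.one_pos⟩) k *
        qp.2 k ⟨α k - 1, Nat.sub_lt (hα k) Nat.one_pos⟩)
    - L (packQV α qp.1 (V qp.1 fun l => qp.2 l ⟨α l - 1, Nat.sub_lt (hα l) Nat.one_pos⟩))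
    + ∑ k : Fin K, ∑ β : Fin (α k),
        if 1 ≤ (β : ℕ) then
          qp.1 k β * qp.2 k ⟨(β : ℕ) - 1, lt_of_le_of_lt (Nat.sub_le _ _) β.isLt⟩
        else 0

/-- Solving the Ostrogradsky recursion: `f 0 - deriv (P 0)` is the alternating sum of iterated
derivatives. -/
theorem sub_deriv_eq_sum_iteratedDeriv (m : ℕ) (f P : ℕ → ℝ → ℝ)
    (hf : ∀ i, ContDiff ℝ (⊤ : ℕ∞) (f i)) (htop : P m = f (m + 1))
    (hrec : ∀ β < m, ∀ t, P β t = f (β + 1) t - deriv (P (β + 1)) t) (t : ℝ) :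
    f 0 t - deriv (P 0) t =
      ∑ σ ∈ Finset.range (m + 2), (-1 : ℝ) ^ σ * iteratedDeriv σ (f σ) t := by
  induction m generalizing f P t with
  | zero => simp [Finset.sum_range_succ, htop, sub_eq_add_neg]
  | succ m ih =>
    have key : P 0 = fun s => ∑ σ ∈ Finset.range (m + 2),
        (-1 : ℝ) ^ σ * iteratedDeriv σ (f (σ + 1)) s := by
      funext s
      rw [hrec 0 m.succ_pos s]
      exact ih (fun i => f (i + 1)) (fun i => P (i + 1)) (fun i => hf _) htop
        (fun β hβ s => hrec (β + 1) (by omega) s) s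
    have hd : ∀ σ, DifferentiableAt ℝ (iteratedDeriv σ (f (σ + 1))) t := fun σ =>
      ((hf (σ + 1)).differentiable_iteratedDeriv σ
        (by exact_mod_cast WithTop.coe_lt_top σ)) t
    rw [key, deriv_fun_sum fun σ _ => (hd σ).const_mul _, Finset.sum_range_succ' _ (m + 2),
      sub_eq_add_neg, ← Finset.sum_neg_distrib, add_comm]
    congr 1
    · refine Finset.sum_congr rfl fun σ _ => ?_
      rw [deriv_const_mul _ (hd σ), iteratedDeriv_succ]
      ring
    · simp

/-- The Fréchet derivative of `L` expanded in the jet coordinates. -/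
theorem fderiv_eq_sum_jetPD {K : ℕ} {α : Fin K → ℕ}
    (L : (∀ k : Fin K, Fin (α k + 1) → ℝ) → ℝ) (a y : ∀ k : Fin K, Fin (α k + 1) → ℝ) :
    fderiv ℝ L a y = ∑ k, ∑ σ, jetPD L a k σ * y k σ := by
  have hy : y = ∑ k, ∑ σ, y k σ • Pi.single k (Pi.single σ (1 : ℝ)) := by
    funext k σ
    simp only [Finset.sum_apply, Pi.smul_apply, smul_eq_mul]
    rw [Finset.sum_eq_single k, Finset.sum_eq_single σ]
    · simp
    · intro τ _ h
      simp [h.symm]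
    · simp
    · intro l _ h
      simp [Pi.single_eq_of_ne h.symm]
    · simp
  conv_lhs => rw [hy]
  simp only [map_sum, map_smul, smul_eq_mul, jetPD]
  exact Finset.sum_congr rfl fun k _ => Finset.sum_congr rfl fun σ _ => mul_comm _ _

theorem HasDerivAt.packQV {K : ℕ} (α : Fin K → ℕ) {q : ℝ → ∀ k : Fin K, Fin (α k) → ℝ}
    {v : ℝ → Fin K → ℝ} {q' : ∀ k : Fin K, Fin (α k) → ℝ} {v' : Fin K → ℝ} {s : ℝ}
    (hq : HasDerivAt q q' s) (hv : HasDerivAt v v' s) :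
    HasDerivAt (fun r => _root_.packQV α (q r) (v r)) (_root_.packQV α q' v') s := by
  refine hasDerivAt_pi.2 fun k => hasDerivAt_pi.2 fun γ => ?_
  unfold _root_.packQV
  split_ifs with h
  · exact hasDerivAt_pi.1 (hasDerivAt_pi.1 hq k) _
  · exact hasDerivAt_pi.1 hv k

theorem Differentiable.packQV {K : ℕ} (α : Fin K → ℕ) {E : Type*} [NormedAddCommGroup E]
    [NormedSpace ℝ E] {q : E → ∀ k : Fin K, Fin (α k) → ℝ} {v : E → Fin K → ℝ}
    (hq : Differentiable ℝ q) (hv : Differentiable ℝ v) :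
    Differentiable ℝ (fun r => _root_.packQV α (q r) (v r)) := by
  refine differentiable_pi.2 fun k => differentiable_pi.2 fun γ => ?_
  unfold _root_.packQV
  split_ifs with h
  · exact differentiable_pi.1 (differentiable_pi.1 hq k) _
  · exact differentiable_pi.1 hv k

/-- The top momenta `(p_{l,α_l-1})_l`. -/
def topMomenta {K : ℕ} {α : Fin K → ℕ} (hα : ∀ k, 1 ≤ α k)
    (p : ∀ k : Fin K, Fin (α k) → ℝ) : Fin K → ℝ :=
  fun l => p l ⟨α l - 1, Nat.sub_lt (hα l) Nat.one_pos⟩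

/-- The differential of the Ostrogradsky Hamiltonian; the terms containing derivatives of `V`
cancel. -/
theorem fderiv_ostroHam {K : ℕ} (α : Fin K → ℕ) (hα : ∀ k, 1 ≤ α k)
    (L : (∀ k : Fin K, Fin (α k + 1) → ℝ) → ℝ) (hL : Differentiable ℝ L)
    (V : (∀ k : Fin K, Fin (α k) → ℝ) → (Fin K → ℝ) → Fin K → ℝ)
    (hV : Differentiable ℝ
      (fun qπ : (∀ k : Fin K, Fin (α k) → ℝ) × (Fin K → ℝ) => V qπ.1 qπ.2))
    (hV1 : ∀ q π k, jetPD L (packQV α q (V q π)) k ⟨α k, Nat.lt_succ_self _⟩ = π k)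
    (q p dq dp : ∀ k : Fin K, Fin (α k) → ℝ) :
    fderiv ℝ (ostroHam α hα L V) (q, p) (dq, dp) =
      (∑ k, V q (topMomenta hα p) k * topMomenta hα dp k)
      - (∑ k, ∑ γ : Fin (α k),
          jetPD L (packQV α q (V q (topMomenta hα p))) k γ.castSucc * dq k γ)
      + ∑ k : Fin K, ∑ β : Fin (α k),
        if 1 ≤ (β : ℕ) then
          dq k β * p k ⟨(β : ℕ) - 1, lt_of_le_of_lt (Nat.sub_le _ _) β.isLt⟩
            + q k β * dp k ⟨(β : ℕ) - 1, lt_of_le_of_lt (Nat.sub_le _ _) β.isLt⟩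
        else 0 := by
  have happ : ∀ (k : Fin K) (i : Fin (α k)), Differentiable ℝ
      (fun z : (∀ k : Fin K, Fin (α k) → ℝ) × (∀ k : Fin K, Fin (α k) → ℝ) => z.2 k i) :=
    fun k i => by fun_prop
  have hVd : Differentiable ℝ
      (fun z : (∀ k : Fin K, Fin (α k) → ℝ) × (∀ k : Fin K, Fin (α k) → ℝ) =>
        V z.1 (topMomenta hα z.2)) :=
    hV.comp (differentiable_fst.prodMk (differentiable_pi.2 fun l => happ l _))
  have hH : Differentiable ℝ (ostroHam α hα L V) := by
    unfold ostroHam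
    refine ((Differentiable.fun_sum fun k _ =>
      (differentiable_pi.1 hVd k).mul (happ k _)).sub
      (hL.comp (Differentiable.packQV α differentiable_fst hVd))).add
      (Differentiable.fun_sum fun k _ => Differentiable.fun_sum fun β _ => ?_)
    split_ifs <;> fun_prop
  have hq : HasDerivAt (fun s : ℝ => q + s • dq) dq 0 := by
    simpa using ((hasDerivAt_id (0 : ℝ)).smul_const dq).const_add q
  have hp : HasDerivAt (fun s : ℝ => p + s • dp) dp 0 := by
    simpa using ((hasDerivAt_id (0 : ℝ)).smul_const dp).const_add p
  have hqi : ∀ k i, HasDerivAt (fun s : ℝ => (q + s • dq) k i) (dq k i) 0 := fun k i =>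
    hasDerivAt_pi.1 (hasDerivAt_pi.1 hq k) i
  have hpi : ∀ k i, HasDerivAt (fun s : ℝ => (p + s • dp) k i) (dp k i) 0 := fun k i =>
    hasDerivAt_pi.1 (hasDerivAt_pi.1 hp k) i
  obtain ⟨v', hv⟩ : ∃ v', HasDerivAt
      (fun s : ℝ => V (q + s • dq) (topMomenta hα (p + s • dp))) v' 0 :=
    by
    have hc := (hVd (q + (0 : ℝ) • dq, p + (0 : ℝ) • dp)).hasFDerivAt.comp_hasDerivAt (0 : ℝ)
      (hq.prodMk hp)
    exact ⟨_, hc⟩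
  have h1 := (hH (q + (0 : ℝ) • dq, p + (0 : ℝ) • dp)).hasFDerivAt.comp_hasDerivAt (0 : ℝ)
    (hq.prodMk hp)
  have hLc := (hL _).hasFDerivAt.comp_hasDerivAt (0 : ℝ) (HasDerivAt.packQV α hq hv)
  have h2 := ((HasDerivAt.fun_sum (u := Finset.univ) fun k _ =>
      (hasDerivAt_pi.1 hv k).mul (hpi k ⟨α k - 1, Nat.sub_lt (hα k) Nat.one_pos⟩)).sub
      hLc).add
    (HasDerivAt.fun_sum (u := Finset.univ) fun k _ => HasDerivAt.fun_sum (u := Finset.univ)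
      fun (β : Fin (α k)) _ =>
      show HasDerivAt (fun s : ℝ => if 1 ≤ (β : ℕ) then (q + s • dq) k β *
          (p + s • dp) k ⟨(β : ℕ) - 1, lt_of_le_of_lt (Nat.sub_le _ _) β.isLt⟩ else 0)
        (if 1 ≤ (β : ℕ) then
          dq k β * p k ⟨(β : ℕ) - 1, lt_of_le_of_lt (Nat.sub_le _ _) β.isLt⟩
            + q k β * dp k ⟨(β : ℕ) - 1, lt_of_le_of_lt (Nat.sub_le _ _) β.isLt⟩
        else 0) 0 by
        split_ifs
        · exact ((hqi k β).fun_mul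
            (hpi k ⟨(β : ℕ) - 1, lt_of_le_of_lt (Nat.sub_le _ _) β.isLt⟩)).congr_deriv
            (by simp)
        · exact hasDerivAt_const _ _)
  have h3 := h1.unique h2
  simp only [zero_smul, add_zero] at h3
  rw [h3, fderiv_eq_sum_jetPD]
  congr 1
  simp only [Fin.sum_univ_castSucc, Finset.sum_add_distrib]
  have e1 : ∀ k, jetPD L (packQV α q (V q (topMomenta hα p))) k (Fin.last (α k)) *
      packQV α dq v' k (Fin.last (α k)) = topMomenta hα p k * v' k := fun k => by
    rw [← hV1 q (topMomenta hα p) k]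
    simp [packQV, Fin.last]
  have e2 : ∀ k (γ : Fin (α k)), packQV α dq v' k γ.castSucc = dq k γ := fun k γ => by
    simp [packQV]
  simp only [e1, e2]
  simp only [topMomenta, mul_comm]
  ring

/-- **Ostrogradsky's theorem for regular higher-order Lagrangians:** a curve satisfies the
Euler–Lagrange equations iff the associated jet/Ostrogradsky-momenta phase-space curve
satisfies Hamilton's equations for the Ostrogradsky Hamiltonian. -/
theorem ostrogradsky_theorem_regular
    (K : ℕ) (hK : 1 ≤ K) (α : Fin K → ℕ) (hα : ∀ k, 1 ≤ α k)
    (L : (∀ k : Fin K, Fin (α k + 1) → ℝ) → ℝ) (hL : ContDiff ℝ (⊤ : ℕ∞) L)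
    (V : (∀ k : Fin K, Fin (α k) → ℝ) → (Fin K → ℝ) → Fin K → ℝ)
    (hV : ContDiff ℝ (⊤ : ℕ∞)
      (fun qπ : (∀ k : Fin K, Fin (α k) → ℝ) × (Fin K → ℝ) => V qπ.1 qπ.2))
    (hV1 : ∀ q π k, jetPD L (packQV α q (V q π)) k ⟨α k, Nat.lt_succ_self _⟩ = π k)
    (hV2 : ∀ q v, (V q fun k => jetPD L (packQV α q v) k ⟨α k, Nat.lt_succ_self _⟩) = v)
    (x : ℝ → Fin K → ℝ) (hx : ∀ k, ContDiff ℝ (⊤ : ℕ∞) (fun t => x t k))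
    (p : Fin K → ℕ → ℝ → ℝ)
    (hptop : ∀ k t, p k (α k - 1) t = jetPD L (jetOf α x t) k ⟨α k, Nat.lt_succ_self _⟩)
    (hprec : ∀ (k : Fin K) (β : ℕ) (_h1 : 1 ≤ β) (_h2 : β ≤ α k - 1) (t : ℝ),
      p k (β - 1) t = jetPD L (jetOf α x t) k ⟨β, by omega⟩ - deriv (p k β) t) :
    (∀ k t, eulerLagrange L x k t = 0) ↔
      (∀ (k : Fin K) (γ : Fin (α k)) (t : ℝ),
        deriv (fun s => tjetOf α x s k γ) t =
          fderiv ℝ (ostroHam α hα L V) (tjetOf α x t, fun l δ => p l (δ : ℕ) t)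
            (0, Pi.single k (Pi.single γ 1)) ∧
        deriv (fun s => p k (γ : ℕ) s) t =
          - fderiv ℝ (ostroHam α hα L V) (tjetOf α x t, fun l δ => p l (δ : ℕ) t)
            (Pi.single k (Pi.single γ 1), 0)) := by
  have hjet : ∀ t, packQV α (tjetOf α x t) (fun k => iteratedDeriv (α k) (fun s => x s k) t) =
      jetOf α x t := fun t => by
    funext k γ
    unfold packQV
    split_ifs with h
    · rfl
    · have : (γ : ℕ) = α k := by omega
      simp [jetOf, this]
  have hVt : ∀ t, V (tjetOf α x t) (topMomenta hα fun l (δ : Fin (α l)) => p l (δ : ℕ) t) =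
      fun k => iteratedDeriv (α k) (fun s => x s k) t := fun t => by
    have h := hV2 (tjetOf α x t) (fun k => iteratedDeriv (α k) (fun s => x s k) t)
    rw [hjet] at h
    rw [← h]
    congr 1
    funext k
    exact hptop k t
  have hLd : Differentiable ℝ L := hL.differentiable (by simp)
  have hH := fun t dq dp => fderiv_ostroHam α hα L hLd V (hV.differentiable (by simp)) hV1
    (tjetOf α x t) (fun l δ => p l (δ : ℕ) t) dq dp
  simp only [hVt, hjet] at hH
  have hjs : ContDiff ℝ (⊤ : ℕ∞) (jetOf α x) := by
    refine contDiff_pi.2 fun k => contDiff_pi.2 fun γ => ?_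
    simpa only [jetOf, iteratedDeriv_eq_iterate] using (hx k).iterate_deriv (γ : ℕ)
  have hfs : ∀ k σ, ContDiff ℝ (⊤ : ℕ∞) (fun t => jetPD L (jetOf α x t) k σ) := fun k σ =>
    ((hL.fderiv_right (m := (⊤ : ℕ∞)) (by simp)).comp hjs).clm_apply contDiff_const
  have hE : ∀ k t, eulerLagrange L x k t = jetPD L (jetOf α x t) k 0 - deriv (p k 0) t := by
    intro k t
    obtain ⟨m, hm⟩ : ∃ m, α k = m + 1 := ⟨α k - 1, by have := hα k; omega⟩
    have h := sub_deriv_eq_sum_iteratedDeriv m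
      (fun σ t => if h : σ < α k + 1 then jetPD L (jetOf α x t) k ⟨σ, h⟩ else 0) (p k)
      (fun i => by
        by_cases h : i < α k + 1
        · simpa [h] using hfs k ⟨i, h⟩
        · simpa [h] using contDiff_const)
      (by
        funext s
        have := hptop k s
        simp only [hm, Nat.add_sub_cancel] at this
        simpa [hm] using this)
      (fun β hβ t => by
        have := hprec k (β + 1) (by omega) (by omega) t
        have h : β + 1 < α k + 1 := by omega
        simpa [h] using this) t
    have hs : m + 2 = α k + 1 := by omega
    rw [hs, ← Fin.sum_univ_eq_sum_range (fun σ => (-1 : ℝ) ^ σ * iteratedDeriv σ (fun t =>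
      if h : σ < α k + 1 then jetPD L (jetOf α x t) k ⟨σ, h⟩ else 0) t)] at h
    simp only [Fin.is_lt, dite_true, Fin.eta] at h
    exact h.symm
  have hp' : ∀ (k : Fin K) (γ : Fin (α k)) (t : ℝ),
      deriv (fun s => tjetOf α x s k γ) t =
          fderiv ℝ (ostroHam α hα L V) (tjetOf α x t, fun l δ => p l (δ : ℕ) t)
            (0, Pi.single k (Pi.single γ 1)) := by
    intro k γ t
    have hl : deriv (fun s => tjetOf α x s k γ) t =
        iteratedDeriv (γ + 1) (fun s => x s k) t := by
      rw [iteratedDeriv_succ]; rfl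
    rw [hl, hH, Finset.sum_eq_single k (fun l _ h => by simp [topMomenta, h]) (by simp),
      Finset.sum_eq_single (s := Finset.univ) (f := fun l => ∑ β : Fin (α l),
        if 1 ≤ (β : ℕ) then _ else _) k (fun l _ h => by simp [h]) (by simp)]
    simp only [topMomenta, Pi.zero_apply, mul_zero, zero_mul, Finset.sum_const_zero, sub_zero,
      zero_add, Pi.single_eq_same]
    by_cases hγ : (γ : ℕ) + 1 = α k
    · have hγ' : γ = ⟨α k - 1, Nat.sub_lt (hα k) Nat.one_pos⟩ := Fin.ext (by simp; omega)
      rw [Finset.sum_eq_zero, ← hγ', hγ]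
      · simp
      · intro β _
        split_ifs with hβ
        · rw [Pi.single_eq_of_ne, mul_zero]
          intro h
          have := congrArg Fin.val h
          have := β.isLt
          simp at *
          omega
        · rfl
    · rw [Pi.single_eq_of_ne, Finset.sum_eq_single ⟨(γ : ℕ) + 1, by omega⟩]
      · simp [tjetOf]
      · intro β _ h
        split_ifs with hβ
        · rw [Pi.single_eq_of_ne, mul_zero]
          intro h'
          have := congrArg Fin.val h'
          refine h (Fin.ext ?_)
          simp at *
          omega
        · rfl
      · simp
      · intro h
        have := congrArg Fin.val h
        simp at this
        omega
  have hq' : ∀ (k : Fin K) (γ : Fin (α k)) (t : ℝ),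
      - fderiv ℝ (ostroHam α hα L V) (tjetOf α x t, fun l δ => p l (δ : ℕ) t)
            (Pi.single k (Pi.single γ 1), 0) =
        jetPD L (jetOf α x t) k γ.castSucc - if 1 ≤ (γ : ℕ) then p k (γ - 1) t else 0 := by
    intro k γ t
    rw [hH, Finset.sum_eq_single (s := Finset.univ) (f := fun l => ∑ β : Fin (α l),
        jetPD L (jetOf α x t) l β.castSucc * _) k (fun l _ h => by simp [h]) (by simp),
      Finset.sum_eq_single (s := Finset.univ) (f := fun l => ∑ β : Fin (α l),
        if 1 ≤ (β : ℕ) then _ else _) k (fun l _ h => by simp [h]) (by simp),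
      Finset.sum_eq_single (s := Finset.univ) (f := fun β : Fin (α k) =>
        jetPD L (jetOf α x t) k β.castSucc * _) γ (fun l _ h => by simp [h]) (by simp),
      Finset.sum_eq_single (s := Finset.univ) (f := fun β : Fin (α k) =>
        if 1 ≤ (β : ℕ) then _ else _) γ (fun l _ h => by simp [h]) (by simp)]
    simp [topMomenta]
    ring
  refine ⟨fun h k γ t => ⟨hp' k γ t, ?_⟩, fun h k t => ?_⟩
  · rw [hq']
    split_ifs with hγ
    · rw [hprec k γ hγ (by omega) t]
      simp [Fin.castSucc, Fin.castAdd, Fin.castLE]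
    · have h0 : γ = ⟨0, hα k⟩ := Fin.ext (by simp; omega)
      subst h0
      have := h k t
      rw [hE] at this
      rw [sub_zero]
      exact (sub_eq_zero.1 this).symm
  · have := (h k ⟨0, hα k⟩ t).2
    rw [hq'] at this
    rw [hE, sub_eq_zero]
    simpa using this.symm
end
end

section
/- Define the Ostrogradsky energy along a sufficiently differentiable curve x by H(t) := Σ_k Σ_{γ=0}^{α_k−1} x_k^{(γ+1)}(t) p_{k,γ}(t) − L(J(t)), where p_{k,γ} are the Ostrogradsky momenta. Then dH/dt = −Σ_{k=1}^{K} (dx_k/dt)(t) · E_k(t) for all t; in particular, H is constant along every solution of the Euler–Lagrange equations E_k = 0. -/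
noncomputable section

/-- The Ostrogradsky energy
`H(t) := Σ_k Σ_{γ=0}^{α_k−1} x_k^{(γ+1)}(t) p_{k,γ}(t) − L(J(t))` along a curve `x`. -/
def ostroEnergy {K : ℕ} (α : Fin K → ℕ)
    (L : (∀ k : Fin K, Fin (α k + 1) → ℝ) → ℝ)
    (x : ℝ → Fin K → ℝ) (p : Fin K → ℕ → ℝ → ℝ) (t : ℝ) : ℝ :=
  (∑ k : Fin K, ∑ γ : Fin (α k),
      iteratedDeriv ((γ : ℕ) + 1) (fun s => x s k) t * p k (γ : ℕ) t)
    - L (jetOf α x t)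

/-- In a finite product of finite real coordinate spaces, a continuous linear functional is
determined by its values on the coordinate vectors. -/
theorem clm_apply_eq_sum_single {ι : Type*} [Fintype ι] [DecidableEq ι] {n : ι → ℕ}
    (φ : (∀ k : ι, Fin (n k) → ℝ) →L[ℝ] ℝ) (v : ∀ k : ι, Fin (n k) → ℝ) :
    φ v = ∑ k, ∑ σ, v k σ * φ (Pi.single k (Pi.single σ 1)) := by
  have hv : v = ∑ k, ∑ σ, v k σ • (Pi.single k (Pi.single σ 1) : ∀ k : ι, Fin (n k) → ℝ) := by
    conv_lhs => rw [← Finset.univ_sum_single v]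
    refine Finset.sum_congr rfl fun k _ => ?_
    conv_lhs => rw [pi_eq_sum_univ' (v k)]
    rw [← LinearMap.single_apply (R := ℝ), map_sum]
    refine Finset.sum_congr rfl fun σ _ => ?_
    rw [map_smul, LinearMap.single_apply]
  conv_lhs => rw [hv]
  simp [map_sum]

theorem contDiff_iteratedDeriv {f : ℝ → ℝ} (hf : ContDiff ℝ (⊤ : ℕ∞) f) (n : ℕ) :
    ContDiff ℝ (⊤ : ℕ∞) (iteratedDeriv n f) := by
  rw [iteratedDeriv_eq_iterate]
  exact hf.iterate_deriv n

/-- Momenta defined by the backward recursion from smooth data are smooth. -/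
theorem contDiff_of_backward_recursion (n : ℕ) (f q : ℕ → ℝ → ℝ)
    (hf : ∀ σ, ContDiff ℝ (⊤ : ℕ∞) (f σ)) (htop : q n = f (n + 1))
    (hrec : ∀ γ < n, q γ = f (γ + 1) - deriv (q (γ + 1))) :
    ∀ γ ≤ n, ContDiff ℝ (⊤ : ℕ∞) (q γ) := by
  intro γ hγ
  induction hγ using Nat.decreasingInduction with
  | self => rw [htop]; exact hf _
  | of_succ γ hγ ih =>
    rw [hrec γ hγ]
    exact (hf _).sub (ih.iterate_deriv 1)

/-- Unfolding the backward recursion yields the alternating Euler–Lagrange sum. -/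
theorem sum_alternating_iteratedDeriv_eq (n : ℕ) (f q : ℕ → ℝ → ℝ)
    (hf : ∀ σ, ContDiff ℝ (⊤ : ℕ∞) (f σ)) (htop : q n = f (n + 1))
    (hrec : ∀ γ < n, q γ = f (γ + 1) - deriv (q (γ + 1))) (t : ℝ) :
    ∑ σ ∈ Finset.range (n + 2), (-1 : ℝ) ^ σ * iteratedDeriv σ (f σ) t =
      f 0 t - deriv (q 0) t := by
  induction n generalizing f q t with
  | zero => simp [Finset.sum_range_succ, htop, sub_eq_add_neg]
  | succ n ih =>
    have key := ih (fun σ => f (σ + 1)) (fun γ => q (γ + 1)) (fun σ => hf _) htop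
      (fun γ hγ => hrec (γ + 1) (by omega))
    have hq : q 0 = fun s => ∑ σ ∈ Finset.range (n + 2),
        (-1 : ℝ) ^ σ * iteratedDeriv σ (f (σ + 1)) s := by
      funext s
      rw [key s, hrec 0 (by omega)]
      rfl
    have hd : ∀ σ, DifferentiableAt ℝ (iteratedDeriv σ (f (σ + 1))) t := fun σ =>
      (contDiff_iteratedDeriv (hf _) σ).differentiable (by simp) t
    rw [hq, deriv_fun_sum fun σ _ => (hd σ).const_mul _, Finset.sum_range_succ']
    simp only [deriv_const_mul _ (hd _), iteratedDeriv_succ, pow_succ]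
    simp [Finset.sum_neg_distrib]
    ring

/-- Summation by parts for the backward recursion. -/
theorem sum_telescope_backward_recursion (n : ℕ) (a b c f : ℕ → ℝ) (htop : b n = f (n + 1))
    (hrec : ∀ γ < n, b γ = f (γ + 1) - c (γ + 1)) :
    ∑ γ ∈ Finset.range (n + 1), (a (γ + 1) * b γ + a γ * c γ) =
      ∑ σ ∈ Finset.range (n + 2), a σ * f σ - a 0 * (f 0 - c 0) := by
  have partial_sum : ∀ m ≤ n, ∑ γ ∈ Finset.range (m + 1), (a (γ + 1) * b γ + a γ * c γ) =
      a (m + 1) * b m + ∑ σ ∈ Finset.range (m + 1), a σ * f σ - a 0 * (f 0 - c 0) := by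
    intro m hm
    induction m with
    | zero => simp; ring
    | succ m ih =>
      rw [Finset.sum_range_succ, ih (by omega), hrec m (by omega),
        Finset.sum_range_succ _ (m + 1)]
      ring
  rw [partial_sum n le_rfl, htop, Finset.sum_range_succ _ (n + 1)]
  ring

/-- The derivative of the kinetic part of the Ostrogradsky energy in one degree of freedom. -/
theorem hasDerivAt_sum_iteratedDeriv_mul (n : ℕ) (f q : ℕ → ℝ → ℝ) (y : ℝ → ℝ)
    (hy : ContDiff ℝ (⊤ : ℕ∞) y)
    (hf : ∀ σ, ContDiff ℝ (⊤ : ℕ∞) (f σ)) (htop : q n = f (n + 1))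
    (hrec : ∀ γ < n, q γ = f (γ + 1) - deriv (q (γ + 1))) (t : ℝ) :
    HasDerivAt (fun s => ∑ γ ∈ Finset.range (n + 1), iteratedDeriv (γ + 1) y s * q γ s)
      (∑ σ ∈ Finset.range (n + 2), iteratedDeriv (σ + 1) y t * f σ t -
        deriv y t *
          ∑ σ ∈ Finset.range (n + 2), (-1 : ℝ) ^ σ * iteratedDeriv σ (f σ) t) t := by
  have hd : ∀ γ ∈ Finset.range (n + 1),
      HasDerivAt (fun s => iteratedDeriv (γ + 1) y s * q γ s)
        (iteratedDeriv (γ + 1 + 1) y t * q γ t + iteratedDeriv (γ + 1) y t * deriv (q γ) t) t := by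
    intro γ hγ
    have hq := contDiff_of_backward_recursion n f q hf htop hrec γ
      (Nat.lt_succ_iff.mp (Finset.mem_range.mp hγ))
    rw [iteratedDeriv_succ (n := γ + 1)]
    exact ((contDiff_iteratedDeriv hy _).differentiable (by simp) t).hasDerivAt.mul
      (hq.differentiable (by simp) t).hasDerivAt
  refine (HasDerivAt.fun_sum hd).congr_deriv ?_
  rw [sum_alternating_iteratedDeriv_eq n f q hf htop hrec,
    sum_telescope_backward_recursion n (fun γ => iteratedDeriv (γ + 1) y t) (fun γ => q γ t)
      (fun γ => deriv (q γ) t) (fun σ => f σ t) (congrFun htop t)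
      (fun γ hγ => congrFun (hrec γ hγ) t)]
  simp

theorem hasDerivAt_jetOf {K : ℕ} (α : Fin K → ℕ) {x : ℝ → Fin K → ℝ}
    (hx : ∀ k, ContDiff ℝ (⊤ : ℕ∞) (fun t => x t k)) (t : ℝ) :
    HasDerivAt (jetOf α x)
      (fun k γ => iteratedDeriv ((γ : ℕ) + 1) (fun s => x s k) t) t := by
  refine hasDerivAt_pi.2 fun k => hasDerivAt_pi.2 fun γ => ?_
  rw [iteratedDeriv_succ]
  exact ((contDiff_iteratedDeriv (hx k) γ).differentiable (by simp) t).hasDerivAt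

theorem contDiff_jetOf {K : ℕ} (α : Fin K → ℕ) {x : ℝ → Fin K → ℝ}
    (hx : ∀ k, ContDiff ℝ (⊤ : ℕ∞) (fun t => x t k)) :
    ContDiff ℝ (⊤ : ℕ∞) (jetOf α x) :=
  contDiff_pi.2 fun k => contDiff_pi.2 fun γ => contDiff_iteratedDeriv (hx k) γ

theorem contDiff_jetPD_jetOf {K : ℕ} {α : Fin K → ℕ}
    {L : (∀ k : Fin K, Fin (α k + 1) → ℝ) → ℝ} (hL : ContDiff ℝ (⊤ : ℕ∞) L)
    {x : ℝ → Fin K → ℝ} (hx : ∀ k, ContDiff ℝ (⊤ : ℕ∞) (fun t => x t k))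
    (k : Fin K) (σ : Fin (α k + 1)) :
    ContDiff ℝ (⊤ : ℕ∞) (fun s => jetPD L (jetOf α x s) k σ) :=
  ((hL.fderiv_right (m := (⊤ : ℕ∞)) (by simp)).comp (contDiff_jetOf α hx)).clm_apply
    contDiff_const

/-- The chain rule for the Lagrangian along the jet of a curve. -/
theorem hasDerivAt_lagrangian_jetOf {K : ℕ} {α : Fin K → ℕ}
    {L : (∀ k : Fin K, Fin (α k + 1) → ℝ) → ℝ} (hL : ContDiff ℝ (⊤ : ℕ∞) L)
    {x : ℝ → Fin K → ℝ} (hx : ∀ k, ContDiff ℝ (⊤ : ℕ∞) (fun t => x t k)) (t : ℝ) :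
    HasDerivAt (fun s => L (jetOf α x s))
      (∑ k, ∑ σ : Fin (α k + 1),
        iteratedDeriv ((σ : ℕ) + 1) (fun s => x s k) t * jetPD L (jetOf α x t) k σ) t := by
  have h := ((hL.differentiable (by simp) (jetOf α x t)).hasFDerivAt).comp_hasDerivAt t
    (hasDerivAt_jetOf α hx t)
  rw [clm_apply_eq_sum_single] at h
  exact h

/-- The derivative of the kinetic part of the Ostrogradsky energy belonging to `x_k`. -/
theorem hasDerivAt_sum_momenta {K : ℕ} {α : Fin K → ℕ} (hα : ∀ k, 1 ≤ α k)
    {L : (∀ k : Fin K, Fin (α k + 1) → ℝ) → ℝ} (hL : ContDiff ℝ (⊤ : ℕ∞) L)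
    {x : ℝ → Fin K → ℝ} (hx : ∀ k, ContDiff ℝ (⊤ : ℕ∞) (fun t => x t k))
    {p : Fin K → ℕ → ℝ → ℝ}
    (hptop : ∀ k t, p k (α k - 1) t = jetPD L (jetOf α x t) k (Fin.last (α k)))
    (hprec : ∀ (k : Fin K) (β : ℕ) (hβ : β < α k + 1), 1 ≤ β → β ≤ α k - 1 → ∀ t : ℝ,
      p k (β - 1) t = jetPD L (jetOf α x t) k ⟨β, hβ⟩ - deriv (p k β) t)
    (k : Fin K) (t : ℝ) :
    HasDerivAt
      (fun s => ∑ γ : Fin (α k), iteratedDeriv ((γ : ℕ) + 1) (fun s => x s k) s * p k (γ : ℕ) s)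
      (∑ σ : Fin (α k + 1),
          iteratedDeriv ((σ : ℕ) + 1) (fun s => x s k) t * jetPD L (jetOf α x t) k σ -
        deriv (fun s => x s k) t * eulerLagrange L x k t) t := by
  let f : ℕ → ℝ → ℝ := fun σ s =>
    if h : σ < α k + 1 then jetPD L (jetOf α x s) k ⟨σ, h⟩ else 0
  have hf_val : ∀ σ : Fin (α k + 1), f σ = fun s => jetPD L (jetOf α x s) k σ := fun σ => by
    funext s
    exact dif_pos σ.isLt
  have hf : ∀ σ, ContDiff ℝ (⊤ : ℕ∞) (f σ) := by
    intro σ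
    by_cases h : σ < α k + 1
    · rw [hf_val ⟨σ, h⟩]
      exact contDiff_jetPD_jetOf hL hx k _
    · simp only [f, h, dite_false]
      exact contDiff_const
  have hα_succ : α k - 1 + 1 = α k := Nat.sub_add_cancel (hα k)
  have htop : p k (α k - 1) = f (α k - 1 + 1) := by
    rw [hα_succ]
    exact (funext (hptop k)).trans (hf_val (Fin.last (α k))).symm
  have hrec : ∀ γ < α k - 1, p k γ = f (γ + 1) - deriv (p k (γ + 1)) := by
    intro γ hγ
    have hγ_lt : γ + 1 < α k + 1 := by omega
    rw [hf_val ⟨γ + 1, hγ_lt⟩]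
    exact funext (hprec k (γ + 1) hγ_lt (by omega) (by omega))
  have h := hasDerivAt_sum_iteratedDeriv_mul (α k - 1) f (p k) (fun s => x s k) (hx k) hf htop
    hrec t
  rw [show α k - 1 + 2 = α k + 1 by omega, hα_succ] at h
  simp only [Finset.sum_range, hf_val] at h
  exact h

/-- **The Ostrogradsky energy satisfies `dH/dt = −Σ_k ẋ_k E_k`**; in particular it is
constant along every solution of the Euler–Lagrange equations. -/
theorem ostrogradsky_energy_theorem
    (K : ℕ) (hK : 1 ≤ K) (α : Fin K → ℕ) (hα : ∀ k, 1 ≤ α k)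
    (L : (∀ k : Fin K, Fin (α k + 1) → ℝ) → ℝ) (hL : ContDiff ℝ (⊤ : ℕ∞) L)
    (x : ℝ → Fin K → ℝ) (hx : ∀ k, ContDiff ℝ (⊤ : ℕ∞) (fun t => x t k))
    (p : Fin K → ℕ → ℝ → ℝ)
    (hptop : ∀ k t, p k (α k - 1) t = jetPD L (jetOf α x t) k ⟨α k, Nat.lt_succ_self _⟩)
    (hprec : ∀ (k : Fin K) (β : ℕ) (_h1 : 1 ≤ β) (_h2 : β ≤ α k - 1) (t : ℝ),
      p k (β - 1) t = jetPD L (jetOf α x t) k ⟨β, by omega⟩ - deriv (p k β) t) :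
    (∀ t, deriv (ostroEnergy α L x p) t =
        - ∑ k : Fin K, deriv (fun s => x s k) t * eulerLagrange L x k t) ∧
    ((∀ k t, eulerLagrange L x k t = 0) →
      ∀ s t, ostroEnergy α L x p s = ostroEnergy α L x p t) := by
  have hH : ∀ t, HasDerivAt (ostroEnergy α L x p)
      (-∑ k : Fin K, deriv (fun s => x s k) t * eulerLagrange L x k t) t := by
    intro t
    refine ((HasDerivAt.fun_sum fun k (_ : k ∈ Finset.univ) =>
      hasDerivAt_sum_momenta hα hL hx hptop (fun k β _ => hprec k β) k t).fun_sub
        (hasDerivAt_lagrangian_jetOf hL hx t)).congr_deriv ?_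
    rw [Finset.sum_sub_distrib]
    ring
  refine ⟨fun t => (hH t).deriv, fun hE => ?_⟩
  refine is_const_of_deriv_eq_zero (fun t => (hH t).differentiableAt) fun t => ?_
  rw [(hH t).deriv]
  simp [hE]
end
end

section
/- Sufficiently differentiable curves (q_{k,γ}(t), λ_{k,β}(t)) satisfy the Euler–Lagrange equations of the extended Lagrangian L̄ with respect to all variables q_{k,γ} (0 ≤ γ ≤ α_k−1) and λ_{k,β} (1 ≤ β ≤ α_k−1) if and only if the following three conditions hold: (i) q_{k,β}(t) = (d/dt)^β q_{k,0}(t) for all k and 1 ≤ β ≤ α_k−1; (ii) the curve x := (q_{1,0},…,q_{K,0}) satisfies the Euler–Lagrange equations of the original higher-order Lagrangian L; and (iii) the multipliers are determined by λ_{k,α_k−1} = d/dt[(∂L/∂q̇_{k,α_k−1}) ∘ J] − (∂L/∂q_{k,α_k−1}) ∘ J and λ_{k,ρ} = −(∂L/∂q_{k,ρ}) ∘ J − dλ_{k,ρ+1}/dt for ρ = α_k−2,…,1, where J is the jet of x. -/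
noncomputable section

/-- The extended first-order Lagrangian
`L̄(q, q̇, λ) := L(q_{k,0},…,q_{k,α_k−1}, q̇_{k,α_k−1}) + Σ_k Σ_{β=1}^{α_k−1}
(q_{k,β} − q̇_{k,β−1}) λ_{k,β}`, as a function of the pair `u = ((q,λ),(q̇,λ̇))`.
Here the multiplier `λ_{k,β}` (for `1 ≤ β ≤ α_k − 1`) is represented by the component
with index `β − 1 : Fin (α_k − 1)`. -/
def extLag {K : ℕ} (α : Fin K → ℕ) (hα : ∀ k, 1 ≤ α k)
    (L : (∀ k : Fin K, Fin (α k + 1) → ℝ) → ℝ)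
    (u : ((∀ k : Fin K, Fin (α k) → ℝ) × (∀ k : Fin K, Fin (α k - 1) → ℝ)) ×
         ((∀ k : Fin K, Fin (α k) → ℝ) × (∀ k : Fin K, Fin (α k - 1) → ℝ))) : ℝ :=
  L (packQV α u.1.1 fun k => u.2.1 k ⟨α k - 1, Nat.sub_lt (hα k) Nat.one_pos⟩)
    + ∑ k : Fin K, ∑ j : Fin (α k - 1),
        (u.1.1 k ⟨(j : ℕ) + 1, by have := j.isLt; omega⟩
            - u.2.1 k ⟨(j : ℕ), by have := j.isLt; omega⟩) * u.1.2 k j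

/-- The Euler–Lagrange expression `∂L̄/∂u_w − d/dt (∂L̄/∂u̇_w)` of the extended Lagrangian
along the curve `t ↦ (q t, λ t)`, in the coordinate direction `w`. -/
def elBar {K : ℕ} (α : Fin K → ℕ) (hα : ∀ k, 1 ≤ α k)
    (L : (∀ k : Fin K, Fin (α k + 1) → ℝ) → ℝ)
    (q : ℝ → ∀ k : Fin K, Fin (α k) → ℝ)
    (lam : ℝ → ∀ k : Fin K, Fin (α k - 1) → ℝ)
    (w : (∀ k : Fin K, Fin (α k) → ℝ) × (∀ k : Fin K, Fin (α k - 1) → ℝ))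
    (t : ℝ) : ℝ :=
  fderiv ℝ (extLag α hα L)
      ((q t, lam t),
        (fun k γ => deriv (fun s => q s k γ) t, fun k j => deriv (fun s => lam s k j) t))
      (w, 0)
    - deriv (fun s =>
        fderiv ℝ (extLag α hα L)
          ((q s, lam s),
            (fun k γ => deriv (fun r => q r k γ) s, fun k j => deriv (fun r => lam r k j) s))
          (0, w)) t

open Finset in
/-- Eliminating the multipliers `m` from the recursion `m_j = -A_j - m_{j+1}'` leaves an
alternating sum of higher derivatives of `A`. -/
theorem alternating_sum_iteratedDeriv_of_recursion {A m : ℕ → ℝ → ℝ} {n : ℕ}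
    (hA : ∀ j, ContDiff ℝ (⊤ : ℕ∞) (A j)) (hm : ∀ j, ContDiff ℝ (⊤ : ℕ∞) (m j))
    (hn : 1 ≤ n) (hlast : ∀ t, m n t = -A n t)
    (hrec : ∀ j, 1 ≤ j → j < n → ∀ t, m j t = -A j t - deriv (m (j + 1)) t) (t : ℝ) :
    ∑ σ ∈ range (n + 1), (-1 : ℝ) ^ σ * iteratedDeriv σ (A σ) t = A 0 t + deriv (m 1) t := by
  have key : ∀ j, 1 ≤ j → j ≤ n →
      ∑ σ ∈ range j, (-1 : ℝ) ^ σ * iteratedDeriv σ (A σ) t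
        - (-1 : ℝ) ^ j * iteratedDeriv j (m j) t = A 0 t + deriv (m 1) t := by
    intro j hj
    induction j, hj using Nat.le_induction with
    | base => intro _; simp [iteratedDeriv_one]
    | succ j hj ih =>
      intro hjn
      have hfun : m j = -(A j + deriv (m (j + 1))) := by
        funext s
        rw [hrec j hj hjn s]
        simp only [Pi.neg_apply, Pi.add_apply]
        ring
      have hd : ContDiff ℝ (⊤ : ℕ∞) (deriv (m (j + 1))) :=
        (contDiff_infty_iff_deriv.1 (hm (j + 1))).2
      have hit : iteratedDeriv j (m j) t
          = -(iteratedDeriv j (A j) t + iteratedDeriv (j + 1) (m (j + 1)) t) := by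
        rw [hfun, iteratedDeriv_neg, iteratedDeriv_add, iteratedDeriv_succ']
        · exact ((hA j).of_le (mod_cast le_top)).contDiffAt
        · exact (hd.of_le (mod_cast le_top)).contDiffAt
      rw [← ih (by omega), sum_range_succ, hit, pow_succ]
      ring
  have hlast' : m n = -A n := funext hlast
  rw [← key n hn le_rfl, sum_range_succ, hlast', iteratedDeriv_neg]
  ring

section Packing

variable {K : ℕ} (α : Fin K → ℕ)

theorem packQV_zero : packQV α 0 0 = 0 := by
  funext k γ
  simp [packQV]

theorem packQV_single_left (k : Fin K) (γ : Fin (α k)) :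
    packQV α (Pi.single k (Pi.single γ 1)) 0 = Pi.single k (Pi.single γ.castSucc 1) := by
  funext l σ
  obtain rfl | hl := eq_or_ne l k
  · by_cases h : (σ : ℕ) < α l
    · simp [packQV, h, Pi.single_apply, Fin.ext_iff]
    · have : (σ : ℕ) ≠ γ := by have := γ.isLt; omega
      simp [packQV, h, Fin.ext_iff, this]
  · simp [packQV, hl]

theorem packQV_single_right (k : Fin K) :
    packQV α 0 (Pi.single k 1) = Pi.single k (Pi.single (Fin.last (α k)) 1) := by
  funext l σ
  obtain rfl | hl := eq_or_ne l k
  · by_cases h : (σ : ℕ) < α l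
    · simp [packQV, h, Fin.ext_iff, h.ne]
    · have : (σ : ℕ) = α l := by have := σ.isLt; omega
      simp [packQV, Pi.single_apply, Fin.ext_iff, this]
  · simp [packQV, hl]

/-- `packQV` as a continuous linear map. -/
def packCLM : ((∀ k : Fin K, Fin (α k) → ℝ) × (Fin K → ℝ)) →L[ℝ]
    (∀ k : Fin K, Fin (α k + 1) → ℝ) :=
  LinearMap.toContinuousLinearMap
    { toFun := fun p => packQV α p.1 p.2
      map_add' := fun p r => by
        funext k γ
        by_cases h : (γ : ℕ) < α k <;> simp [packQV, h]
      map_smul' := fun c p => by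
        funext k γ
        by_cases h : (γ : ℕ) < α k <;> simp [packQV, h] }

end Packing

section ExtendedLagrangian

variable {K : ℕ} {α : Fin K → ℕ} (hα : ∀ k, 1 ≤ α k)
  {L : (∀ k : Fin K, Fin (α k + 1) → ℝ) → ℝ}

theorem fderiv_extLag (hL : Differentiable ℝ L)
    (u d : ((∀ k : Fin K, Fin (α k) → ℝ) × (∀ k : Fin K, Fin (α k - 1) → ℝ)) ×
         ((∀ k : Fin K, Fin (α k) → ℝ) × (∀ k : Fin K, Fin (α k - 1) → ℝ))) :
    fderiv ℝ (extLag α hα L) u d =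
      fderiv ℝ L (packQV α u.1.1 fun k => u.2.1 k ⟨α k - 1, Nat.sub_lt (hα k) Nat.one_pos⟩)
        (packQV α d.1.1 fun k => d.2.1 k ⟨α k - 1, Nat.sub_lt (hα k) Nat.one_pos⟩)
      + ∑ k : Fin K, ∑ j : Fin (α k - 1),
        ((u.1.1 k ⟨(j : ℕ) + 1, by have := j.isLt; omega⟩
            - u.2.1 k ⟨(j : ℕ), by have := j.isLt; omega⟩) * d.1.2 k j
          + u.1.2 k j * (d.1.1 k ⟨(j : ℕ) + 1, by have := j.isLt; omega⟩
            - d.2.1 k ⟨(j : ℕ), by have := j.isLt; omega⟩)) := by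
  let X := ∀ k : Fin K, Fin (α k) → ℝ
  let Y := ∀ k : Fin K, Fin (α k - 1) → ℝ
  let cX : ∀ k, Fin (α k) → (X →L[ℝ] ℝ) := fun k i =>
    (ContinuousLinearMap.proj i).comp
      (ContinuousLinearMap.proj (R := ℝ) (φ := fun k : Fin K => Fin (α k) → ℝ) k)
  let cY : ∀ k, Fin (α k - 1) → (Y →L[ℝ] ℝ) := fun k i =>
    (ContinuousLinearMap.proj i).comp
      (ContinuousLinearMap.proj (R := ℝ) (φ := fun k : Fin K => Fin (α k - 1) → ℝ) k)
  let pq : ((X × Y) × (X × Y)) →L[ℝ] X :=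
    (ContinuousLinearMap.fst ℝ X Y).comp (ContinuousLinearMap.fst ℝ (X × Y) (X × Y))
  let pl : ((X × Y) × (X × Y)) →L[ℝ] Y :=
    (ContinuousLinearMap.snd ℝ X Y).comp (ContinuousLinearMap.fst ℝ (X × Y) (X × Y))
  let pv : ((X × Y) × (X × Y)) →L[ℝ] X :=
    (ContinuousLinearMap.fst ℝ X Y).comp (ContinuousLinearMap.snd ℝ (X × Y) (X × Y))
  let P : ((X × Y) × (X × Y)) →L[ℝ] (∀ k : Fin K, Fin (α k + 1) → ℝ) :=
    (packCLM α).comp (pq.prod (ContinuousLinearMap.pi fun k =>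
      (cX k ⟨α k - 1, Nat.sub_lt (hα k) Nat.one_pos⟩).comp pv))
  have h1 : HasFDerivAt (fun u => L (P u)) ((fderiv ℝ L (P u)).comp P) u :=
    (hL (P u)).hasFDerivAt.comp u P.hasFDerivAt
  let a : ∀ k, Fin (α k - 1) → (((X × Y) × (X × Y)) →L[ℝ] ℝ) := fun k j =>
    (cX k ⟨(j : ℕ) + 1, by have := j.isLt; omega⟩).comp pq
      - (cX k ⟨(j : ℕ), by have := j.isLt; omega⟩).comp pv
  let b : ∀ k, Fin (α k - 1) → (((X × Y) × (X × Y)) →L[ℝ] ℝ) := fun k j => (cY k j).comp pl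
  have h2 : HasFDerivAt (fun u => ∑ k : Fin K, ∑ j : Fin (α k - 1), a k j u * b k j u)
      (∑ k : Fin K, ∑ j : Fin (α k - 1), (a k j u • b k j + b k j u • a k j)) u :=
    HasFDerivAt.fun_sum fun k _ => HasFDerivAt.fun_sum fun j _ =>
      (a k j).hasFDerivAt.mul (b k j).hasFDerivAt
  have h3 : HasFDerivAt (extLag α hα L) _ u := h1.add h2
  rw [h3.fderiv]
  simp only [add_apply, sum_apply,
    smul_apply, smul_eq_mul]
  rfl

end ExtendedLagrangian

theorem sum_fin_ite_val_eq {n : ℕ} (c : Fin n → ℝ) (m : ℕ) :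
    (∑ j : Fin n, if (j : ℕ) = m then c j else 0) = if h : m < n then c ⟨m, h⟩ else 0 := by
  split_ifs with h
  · rw [Finset.sum_eq_single ⟨m, h⟩]
    · simp
    · intro j _ hj
      exact if_neg fun hjm => hj (Fin.ext hjm)
    · simp
  · exact Finset.sum_eq_zero fun j _ => if_neg (by have := j.isLt; omega)

theorem sum_mul_single_single {K : ℕ} {m n : Fin K → ℕ} (c : ∀ k, Fin (m k) → ℝ)
    (f : ∀ k, Fin (m k) → Fin (n k)) (k : Fin K) (γ : Fin (n k)) :
    ∑ l : Fin K, ∑ j : Fin (m l),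
        c l j * (Pi.single k (Pi.single γ 1) : ∀ k, Fin (n k) → ℝ) l (f l j)
      = ∑ j : Fin (m k), if (f k j : ℕ) = γ then c k j else 0 := by
  rw [Finset.sum_eq_single k]
  · simp [Pi.single_apply, Fin.ext_iff]
  · intro l _ hl
    simp [hl]
  · simp

/-- The jet coordinates `(q, q̇_top)` fed into `L` by the extended Lagrangian. -/
def curveJet {K : ℕ} {α : Fin K → ℕ} (hα : ∀ k, 1 ≤ α k)
    (q : ℝ → ∀ k : Fin K, Fin (α k) → ℝ) (t : ℝ) : ∀ k : Fin K, Fin (α k + 1) → ℝ :=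
  packQV α (q t) fun k =>
    deriv (fun s => q s k ⟨α k - 1, Nat.sub_lt (hα k) Nat.one_pos⟩) t

/-- The multipliers `λ_{k,n}` for `1 ≤ n ≤ α_k - 1`, extended by `0` at `n = 0` and by `-B`
beyond `α_k - 1`. -/
def extMultiplier {K : ℕ} {α : Fin K → ℕ} (lam : ℝ → ∀ k : Fin K, Fin (α k - 1) → ℝ)
    (B : ℝ → ℝ) (k : Fin K) (n : ℕ) (t : ℝ) : ℝ :=
  if h : 1 ≤ n ∧ n ≤ α k - 1 then lam t k ⟨n - 1, by omega⟩ else if n = 0 then 0 else -B t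

/-- The partial derivatives `∂L/∂x_k^{(σ)}` along a jet curve, indexed by all `σ : ℕ`. -/
def partialAlong {K : ℕ} {α : Fin K → ℕ} (L : (∀ k : Fin K, Fin (α k + 1) → ℝ) → ℝ)
    (J : ℝ → ∀ k : Fin K, Fin (α k + 1) → ℝ) (k : Fin K) (σ : ℕ) (t : ℝ) : ℝ :=
  if h : σ < α k + 1 then jetPD L (J t) k ⟨σ, h⟩ else 0

theorem partialAlong_of_lt {K : ℕ} {α : Fin K → ℕ}
    {L : (∀ k : Fin K, Fin (α k + 1) → ℝ) → ℝ}
    {J : ℝ → ∀ k : Fin K, Fin (α k + 1) → ℝ} {k : Fin K} {σ : ℕ} (h : σ < α k + 1) (t : ℝ) :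
    partialAlong L J k σ t = jetPD L (J t) k ⟨σ, h⟩ :=
  dif_pos h

theorem contDiff_partialAlong {K : ℕ} {α : Fin K → ℕ}
    {L : (∀ k : Fin K, Fin (α k + 1) → ℝ) → ℝ} (hL : ContDiff ℝ (⊤ : ℕ∞) L)
    {J : ℝ → ∀ k : Fin K, Fin (α k + 1) → ℝ} (hJ : ContDiff ℝ (⊤ : ℕ∞) J)
    (k : Fin K) (σ : ℕ) : ContDiff ℝ (⊤ : ℕ∞) (partialAlong L J k σ) := by
  by_cases h : σ < α k + 1
  · rw [funext (partialAlong_of_lt h)]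
    exact ((hL.fderiv_right (m := (⊤ : ℕ∞)) (by simp)).comp hJ).clm_apply contDiff_const
  · have : partialAlong L J k σ = fun _ => 0 := funext fun t => dif_neg h
    rw [this]
    exact contDiff_const

theorem contDiff_extMultiplier {K : ℕ} {α : Fin K → ℕ}
    {lam : ℝ → ∀ k : Fin K, Fin (α k - 1) → ℝ} {B : ℝ → ℝ}
    (hlam : ∀ k j, ContDiff ℝ (⊤ : ℕ∞) (fun t => lam t k j)) (hB : ContDiff ℝ (⊤ : ℕ∞) B)
    (k : Fin K) (n : ℕ) : ContDiff ℝ (⊤ : ℕ∞) (extMultiplier lam B k n) := by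
  unfold extMultiplier
  split_ifs
  · exact hlam _ _
  · exact contDiff_const
  · exact hB.neg

theorem contDiff_curveJet {K : ℕ} {α : Fin K → ℕ} (hα : ∀ k, 1 ≤ α k)
    {q : ℝ → ∀ k : Fin K, Fin (α k) → ℝ}
    (hq : ∀ k γ, ContDiff ℝ (⊤ : ℕ∞) (fun t => q t k γ)) :
    ContDiff ℝ (⊤ : ℕ∞) (curveJet hα q) := by
  refine contDiff_pi.2 fun k => contDiff_pi.2 fun γ => ?_
  unfold curveJet packQV
  split_ifs
  · exact hq _ _
  · exact (contDiff_infty_iff_deriv.1 (hq _ _)).2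

theorem eulerLagrange_eq_sum_range {K : ℕ} {α : Fin K → ℕ}
    (L : (∀ k : Fin K, Fin (α k + 1) → ℝ) → ℝ) (x : ℝ → Fin K → ℝ) (k : Fin K) (t : ℝ) :
    eulerLagrange L x k t = ∑ σ ∈ Finset.range (α k + 1),
      (-1 : ℝ) ^ σ * iteratedDeriv σ (partialAlong L (jetOf α x) k σ) t := by
  rw [Finset.sum_range]
  refine Finset.sum_congr rfl fun σ _ => ?_
  rw [funext (partialAlong_of_lt σ.isLt)]

section ExtendedEquations

variable {K : ℕ} {α : Fin K → ℕ} (hα : ∀ k, 1 ≤ α k)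
  {L : (∀ k : Fin K, Fin (α k + 1) → ℝ) → ℝ}

theorem elBar_multiplier (hL : Differentiable ℝ L) (q : ℝ → ∀ k : Fin K, Fin (α k) → ℝ)
    (lam : ℝ → ∀ k : Fin K, Fin (α k - 1) → ℝ) (k : Fin K) (j : Fin (α k - 1)) (t : ℝ) :
    elBar α hα L q lam (0, Pi.single k (Pi.single j 1)) t =
      q t k ⟨(j : ℕ) + 1, by have := j.isLt; omega⟩
        - deriv (fun s => q s k ⟨(j : ℕ), by have := j.isLt; omega⟩) t := by
  simp only [elBar, fderiv_extLag hα hL, Prod.fst_zero, Prod.snd_zero, Pi.zero_apply, sub_zero,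
    mul_zero, add_zero, Finset.sum_const_zero]
  simp only [show packQV α 0 (fun _ => (0 : ℝ)) = 0 from packQV_zero α, map_zero, zero_add,
    deriv_const, sub_zero]
  rw [sum_mul_single_single (n := fun k => α k - 1) _ (fun _ j => j), sum_fin_ite_val_eq,
    dif_pos j.isLt]

theorem elBar_position (hL : Differentiable ℝ L) (q : ℝ → ∀ k : Fin K, Fin (α k) → ℝ)
    (lam : ℝ → ∀ k : Fin K, Fin (α k - 1) → ℝ) (k : Fin K) (γ : Fin (α k)) (t : ℝ) :
    elBar α hα L q lam (Pi.single k (Pi.single γ 1), 0) t =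
      partialAlong L (curveJet hα q) k γ t
        + extMultiplier lam (partialAlong L (curveJet hα q) k (α k)) k γ t
        + deriv (extMultiplier lam (partialAlong L (curveJet hα q) k (α k)) k (γ + 1)) t := by
  have hγ := γ.isLt
  have hpos : ∀ u v : ((∀ k : Fin K, Fin (α k) → ℝ) × (∀ k : Fin K, Fin (α k - 1) → ℝ)),
      fderiv ℝ (extLag α hα L) (u, v) ((Pi.single k (Pi.single γ 1), 0), 0)
        = jetPD L (packQV α u.1 fun k => v.1 k ⟨α k - 1, Nat.sub_lt (hα k) Nat.one_pos⟩) k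
            γ.castSucc
          + if h : 1 ≤ (γ : ℕ) then u.2 k ⟨γ - 1, by omega⟩ else 0 := by
    intro u v
    simp only [fderiv_extLag hα hL, Prod.fst_zero, Pi.zero_apply, sub_zero, mul_zero, zero_add]
    rw [show (fun _ : Fin K => (0 : ℝ)) = 0 from rfl, packQV_single_left,
      sum_mul_single_single (n := α) _ (fun k (j : Fin (α k - 1)) => ⟨(j : ℕ) + 1, by omega⟩)]
    congr 1
    split_ifs with h
    · have : ∀ j : Fin (α k - 1), (j : ℕ) + 1 = γ ↔ (j : ℕ) = γ - 1 := fun j => by omega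
      simp only [this]
      rw [sum_fin_ite_val_eq, dif_pos]
    · exact Finset.sum_eq_zero fun j _ => if_neg (by simp only; omega)
  have hvel : ∀ u v : ((∀ k : Fin K, Fin (α k) → ℝ) × (∀ k : Fin K, Fin (α k - 1) → ℝ)),
      fderiv ℝ (extLag α hα L) (u, v) (0, (Pi.single k (Pi.single γ 1), 0))
        = if h : (γ : ℕ) < α k - 1 then -u.2 k ⟨γ, h⟩ else
          jetPD L (packQV α u.1 fun k => v.1 k ⟨α k - 1, Nat.sub_lt (hα k) Nat.one_pos⟩) k
            (Fin.last (α k)) := by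
    intro u v
    simp only [fderiv_extLag hα hL, Prod.fst_zero, Prod.snd_zero, Pi.zero_apply, zero_sub,
      mul_zero, zero_add, mul_neg, Finset.sum_neg_distrib]
    rw [sum_mul_single_single (n := α) _ (fun k (j : Fin (α k - 1)) => ⟨(j : ℕ), by omega⟩),
      sum_fin_ite_val_eq]
    have hdir : (fun l : Fin K => (Pi.single k (Pi.single γ 1) : ∀ k, Fin (α k) → ℝ) l
        ⟨α l - 1, Nat.sub_lt (hα l) Nat.one_pos⟩)
          = if (γ : ℕ) < α k - 1 then 0 else Pi.single k 1 := by
      funext l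
      obtain rfl | hl := eq_or_ne l k
      · split_ifs with h
        · simp [Fin.ext_iff, h.ne']
        · have : α l - 1 = γ := by omega
          simp [this]
      · split_ifs <;> simp [hl]
    rw [hdir]
    split_ifs with h
    · rw [packQV_zero, map_zero, zero_add]
    · rw [packQV_single_right, neg_zero, add_zero]
      rfl
  have hvel' : (fun s => fderiv ℝ (extLag α hα L)
      ((q s, lam s),
        (fun k γ => deriv (fun r => q r k γ) s, fun k j => deriv (fun r => lam r k j) s))
      (0, (Pi.single k (Pi.single γ 1), 0)))
      = -extMultiplier lam (partialAlong L (curveJet hα q) k (α k)) k (γ + 1) := by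
    funext s
    rw [hvel, Pi.neg_apply, extMultiplier]
    by_cases h : (γ : ℕ) < α k - 1
    · rw [dif_pos h, dif_pos (by omega)]
      rfl
    · rw [dif_neg h, dif_neg (by omega), if_neg (by omega), neg_neg,
        partialAlong_of_lt (Nat.lt_succ_self _)]
      rfl
  rw [elBar, hpos, hvel', deriv.neg, sub_neg_eq_add, partialAlong_of_lt (by omega)]
  congr 2
  rw [extMultiplier]
  by_cases h : 1 ≤ (γ : ℕ)
  · rw [dif_pos h, dif_pos (by omega)]
  · rw [dif_neg h, dif_neg (by omega), if_pos (by omega)]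

/-- Along a curve satisfying the constraints, `curveJet` is the jet of the base curve. -/
theorem jetOf_eq_curveJet {q : ℝ → ∀ k : Fin K, Fin (α k) → ℝ}
    (hcon : ∀ (k : Fin K) (β : Fin (α k)) (t : ℝ),
      q t k β = iteratedDeriv (β : ℕ) (fun s => q s k ⟨0, hα k⟩) t) :
    jetOf α (fun s l => q s l ⟨0, hα l⟩) = curveJet hα q := by
  funext t k γ
  unfold jetOf curveJet packQV
  split_ifs with h
  · exact (hcon k ⟨γ, h⟩ t).symm
  · have hγ : (γ : ℕ) = α k - 1 + 1 := by have := hα k; omega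
    rw [hγ, iteratedDeriv_succ, ← funext (hcon k ⟨α k - 1, Nat.sub_lt (hα k) Nat.one_pos⟩)]

theorem constraints_iff (hL : Differentiable ℝ L) (q : ℝ → ∀ k : Fin K, Fin (α k) → ℝ)
    (lam : ℝ → ∀ k : Fin K, Fin (α k - 1) → ℝ) :
    (∀ (k : Fin K) (j : Fin (α k - 1)) (t : ℝ),
        elBar α hα L q lam (0, Pi.single k (Pi.single j 1)) t = 0) ↔
      ∀ (k : Fin K) (β : Fin (α k)) (t : ℝ),
        q t k β = iteratedDeriv (β : ℕ) (fun s => q s k ⟨0, hα k⟩) t := by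
  simp only [elBar_multiplier hα hL, sub_eq_zero]
  constructor
  · rintro h k ⟨β, hβ⟩
    induction β with
    | zero => simp
    | succ β ih =>
      intro t
      rw [h k ⟨β, by omega⟩ t, iteratedDeriv_succ, ← funext (ih (by omega))]
  · intro h k j t
    rw [h k, iteratedDeriv_succ, funext (h k ⟨j, by have := j.isLt; omega⟩)]

end ExtendedEquations

/-- **Equivalence of the Euler–Lagrange equations of the extended Lagrangian `L̄` with
(i) the Lagrangian constraints, (ii) the Euler–Lagrange equations of `L`, and
(iii) the determination of the multipliers.** -/
theorem extended_lagrangian_equivalence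
    (K : ℕ) (hK : 1 ≤ K) (α : Fin K → ℕ) (hα : ∀ k, 1 ≤ α k)
    (L : (∀ k : Fin K, Fin (α k + 1) → ℝ) → ℝ) (hL : ContDiff ℝ (⊤ : ℕ∞) L)
    (q : ℝ → ∀ k : Fin K, Fin (α k) → ℝ)
    (lam : ℝ → ∀ k : Fin K, Fin (α k - 1) → ℝ)
    (hq : ∀ k γ, ContDiff ℝ (⊤ : ℕ∞) (fun t => q t k γ))
    (hlam : ∀ k j, ContDiff ℝ (⊤ : ℕ∞) (fun t => lam t k j)) :
    ((∀ (k : Fin K) (γ : Fin (α k)) (t : ℝ),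
        elBar α hα L q lam (Pi.single k (Pi.single γ 1), 0) t = 0) ∧
     (∀ (k : Fin K) (j : Fin (α k - 1)) (t : ℝ),
        elBar α hα L q lam (0, Pi.single k (Pi.single j 1)) t = 0)) ↔
    ((∀ (k : Fin K) (β : ℕ) (_h1 : 1 ≤ β) (_h2 : β ≤ α k - 1) (t : ℝ),
        q t k ⟨β, by omega⟩ = iteratedDeriv β (fun s => q s k ⟨0, hα k⟩) t) ∧
     (∀ (k : Fin K) (t : ℝ),
        eulerLagrange L (fun s l => q s l ⟨0, hα l⟩) k t = 0) ∧
     (∀ (k : Fin K) (_h2 : 2 ≤ α k) (t : ℝ),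
        lam t k ⟨α k - 2, by omega⟩ =
          deriv (fun s =>
              jetPD L (jetOf α (fun r l => q r l ⟨0, hα l⟩) s) k
                ⟨α k, Nat.lt_succ_self _⟩) t
            - jetPD L (jetOf α (fun r l => q r l ⟨0, hα l⟩) t) k ⟨α k - 1, by omega⟩) ∧
     (∀ (k : Fin K) (ρ : ℕ) (_h1 : 1 ≤ ρ) (_h2 : ρ ≤ α k - 2) (t : ℝ),
        lam t k ⟨ρ - 1, by omega⟩ =
          - jetPD L (jetOf α (fun r l => q r l ⟨0, hα l⟩) t) k ⟨ρ, by omega⟩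
            - deriv (fun s => lam s k ⟨ρ, by omega⟩) t)) := by

  have hLd : Differentiable ℝ L := hL.differentiable (by simp)
  have hcon_iff : (∀ (k : Fin K) (β : ℕ) (_h1 : 1 ≤ β) (_h2 : β ≤ α k - 1) (t : ℝ),
        q t k ⟨β, by have := hα k; omega⟩ = iteratedDeriv β (fun s => q s k ⟨0, hα k⟩) t) ↔
      ∀ (k : Fin K) (β : Fin (α k)) (t : ℝ),
        q t k β = iteratedDeriv (β : ℕ) (fun s => q s k ⟨0, hα k⟩) t := by
    refine forall_congr' fun k => ⟨?_, fun h β _ h2 => h ⟨β, by have := hα k; omega⟩⟩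
    rintro h ⟨β, hβ⟩ t
    rcases Nat.eq_zero_or_pos β with rfl | hpos
    · simp
    · exact h β hpos (by omega) t
  rw [hcon_iff, constraints_iff hα hLd, and_comm]
  refine and_congr_right fun hcon => ?_
  simp only [eulerLagrange_eq_sum_range, jetOf_eq_curveJet hα hcon, elBar_position hα hLd,
    ← forall_and]
  refine forall_congr' fun k => ?_
  set A := partialAlong L (curveJet hα q) k with hAdef
  set m := extMultiplier lam (A (α k)) k with hmdef
  have hαk := hα k
  have hA : ∀ j, ContDiff ℝ (⊤ : ℕ∞) (A j) :=
    contDiff_partialAlong hL (contDiff_curveJet hα hq) k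
  have hm : ∀ j, ContDiff ℝ (⊤ : ℕ∞) (m j) := contDiff_extMultiplier hlam (hA _) k
  have hAσ : ∀ σ (h : σ < α k + 1),
      (fun t => jetPD L (curveJet hα q t) k ⟨σ, h⟩) = A σ :=
    fun σ h => funext fun t => (partialAlong_of_lt h t).symm
  have hm0 : ∀ t, m 0 t = 0 := fun t => by simp [hmdef, extMultiplier]
  have hmlast : ∀ t, m (α k) t = -A (α k) t := fun t => by
    rw [hmdef, extMultiplier, dif_neg (by omega), if_neg (by omega)]
  have hmlam : ∀ i (h1 : 1 ≤ i) (h2 : i ≤ α k - 1),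
      (fun t => lam t k ⟨i - 1, by omega⟩) = m i :=
    fun i h1 h2 => funext fun t => by rw [hmdef, extMultiplier, dif_pos ⟨h1, h2⟩]
  have hsum := alternating_sum_iteratedDeriv_of_recursion hA hm hαk hmlast
  have hrec_iff : (∀ j, 1 ≤ j → j < α k → ∀ t, m j t = -A j t - deriv (m (j + 1)) t) ↔
      (∀ (_h2 : 2 ≤ α k) (t : ℝ), lam t k ⟨α k - 2, by omega⟩ =
          deriv (fun s => jetPD L (curveJet hα q s) k ⟨α k, Nat.lt_succ_self _⟩) t
            - jetPD L (curveJet hα q t) k ⟨α k - 1, by omega⟩) ∧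
      (∀ (ρ : ℕ) (_h1 : 1 ≤ ρ) (_h2 : ρ ≤ α k - 2) (t : ℝ), lam t k ⟨ρ - 1, by omega⟩ =
          - jetPD L (curveJet hα q t) k ⟨ρ, by omega⟩
            - deriv (fun s => lam s k ⟨ρ, by omega⟩) t) := by
    have htop : ∀ (_h2 : 2 ≤ α k) (t : ℝ), (lam t k ⟨α k - 2, by omega⟩ =
          deriv (fun s => jetPD L (curveJet hα q s) k ⟨α k, Nat.lt_succ_self _⟩) t
            - jetPD L (curveJet hα q t) k ⟨α k - 1, by omega⟩) ↔
        m (α k - 1) t = -A (α k - 1) t - deriv (m (α k - 1 + 1)) t := by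
      intro h2 t
      have e1 : m (α k - 1 + 1) = -A (α k) := by
        rw [Nat.sub_add_cancel hαk]
        exact funext hmlast
      have e2 : lam t k ⟨α k - 2, by omega⟩ = m (α k - 1) t :=
        congrFun (hmlam (α k - 1) (by omega) le_rfl) t
      have e3 := congrFun (hAσ (α k - 1) (by omega)) t
      rw [hAσ, e1, e2, e3, deriv.neg, sub_neg_eq_add, neg_add_eq_sub]
    have hlow : ∀ (ρ : ℕ) (_h1 : 1 ≤ ρ) (_h2 : ρ ≤ α k - 2) (t : ℝ),
        (lam t k ⟨ρ - 1, by omega⟩ = - jetPD L (curveJet hα q t) k ⟨ρ, by omega⟩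
            - deriv (fun s => lam s k ⟨ρ, by omega⟩) t) ↔
        m ρ t = -A ρ t - deriv (m (ρ + 1)) t := by
      intro ρ h1 h2 t
      have e1 : (fun s => lam s k ⟨ρ, by omega⟩) = m (ρ + 1) :=
        hmlam (ρ + 1) (by omega) (by omega)
      have e2 := congrFun (hmlam ρ h1 (by omega)) t
      have e3 := congrFun (hAσ ρ (by omega)) t
      rw [e1, e2, e3]
    constructor
    · intro h
      exact ⟨fun h2 t => (htop h2 t).2 (h _ (by omega) (by omega) t),
        fun ρ h1 h2 t => (hlow ρ h1 h2 t).2 (h ρ h1 (by omega) t)⟩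
    · rintro ⟨h, h'⟩ j h1 h2 t
      by_cases hj : j = α k - 1
      · subst hj
        exact (htop (by omega) t).1 (h (by omega) t)
      · exact (hlow j h1 (by omega) t).1 (h' j h1 (by omega) t)
  rw [← hrec_iff]
  constructor
  · intro h
    have hrec : ∀ j, 1 ≤ j → j < α k → ∀ t, m j t = -A j t - deriv (m (j + 1)) t :=
      fun j _ h2 t => by linear_combination h ⟨j, h2⟩ t
    refine ⟨fun t => ?_, hrec⟩
    rw [hsum hrec t]
    linear_combination h ⟨0, hαk⟩ t - hm0 t
  · rintro ⟨hEL, hrec⟩ ⟨j, hj⟩ t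
    rcases Nat.eq_zero_or_pos j with rfl | hpos
    · linear_combination hEL t - hsum hrec t + hm0 t
    · linear_combination hrec j hpos hj t
end
end

section
/- Under the stated hypotheses, for all (q, v) ∈ ℝ^m × ℝ^K the following identity holds: (∂H_r/∂q)(q, p̂(q,v)) = − Σ_{i=1}^{R} ω^i(q,v) (∂φ_i/∂q)(q, p̂(q,v)) − (∂L/∂q)(q,v). -/
noncomputable section

/-- The momentum map `p̂(q,v) := (∂L/∂v)(q,v)`. -/
def momMap {m K : ℕ} (L : (Fin m → ℝ) × (Fin K → ℝ) → ℝ)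
    (q : Fin m → ℝ) (v : Fin K → ℝ) (k : Fin K) : ℝ :=
  fderiv ℝ L (q, v) (0, Pi.single k 1)

/-- The momentum map of a smooth Lagrangian is differentiable along a fixed velocity. -/
theorem differentiable_momMap_left {m K : ℕ} {L : (Fin m → ℝ) × (Fin K → ℝ) → ℝ}
    (hL : ContDiff ℝ (⊤ : ℕ∞) L) (v : Fin K → ℝ) :
    Differentiable ℝ fun q => momMap L q v := by
  rw [differentiable_pi]
  intro k
  have hd : Differentiable ℝ (fderiv ℝ L) :=
    (hL.fderiv_right (m := 1) (by norm_cast)).differentiable (by norm_num)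
  have hc : Differentiable ℝ fun q => fderiv ℝ L (q, v) :=
    hd.comp (differentiable_id.prodMk (differentiable_const v))
  exact hc.clm_apply (differentiable_const _)

/-- A continuous linear functional on a product, expanded in the standard basis of the second
factor. -/
theorem clm_prod_apply_eq_add_sum {E : Type*} [AddCommGroup E] [Module ℝ E] [TopologicalSpace E]
    {K : ℕ} (A : E × (Fin K → ℝ) →L[ℝ] ℝ) (x : E) (w : Fin K → ℝ) :
    A (x, w) = A (x, 0) + ∑ k, w k * A (0, Pi.single k 1) := by
  have h1 : (x, w) = (x, 0) + (0, w) := by simp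
  have h2 : A (0, w) = ∑ k, w k * A (0, Pi.single k 1) := by
    have h (k : Fin K) : (fun j => if k = j then (1 : ℝ) else 0) = Pi.single k 1 := by
      ext j
      simp [Pi.single_apply, eq_comm]
    simpa [h] using LinearMap.pi_apply_eq_sum_univ
      ((A : E × (Fin K → ℝ) →ₗ[ℝ] ℝ) ∘ₗ LinearMap.inr ℝ E (Fin K → ℝ)) w
  rw [h1, map_add, h2]

/-- **Identity for the restricted Hamiltonian of a (possibly singular) Lagrangian:**
`(∂H_r/∂q)(q, p̂(q,v)) = − Σ_i ω^i(q,v) (∂φ_i/∂q)(q, p̂(q,v)) − (∂L/∂q)(q,v)`. -/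
theorem restricted_hamiltonian_identity
    (m K R : ℕ)
    (L : (Fin m → ℝ) × (Fin K → ℝ) → ℝ) (hL : ContDiff ℝ (⊤ : ℕ∞) L)
    (Hr : (Fin m → ℝ) × (Fin K → ℝ) → ℝ) (hHr : ContDiff ℝ (⊤ : ℕ∞) Hr)
    (φ : Fin R → (Fin m → ℝ) × (Fin K → ℝ) → ℝ) (hφ : ∀ i, ContDiff ℝ (⊤ : ℕ∞) (φ i))
    (ω : Fin R → (Fin m → ℝ) × (Fin K → ℝ) → ℝ) (hω : ∀ i, ContDiff ℝ (⊤ : ℕ∞) (ω i))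
    (hHrL : ∀ q v,
      Hr (q, momMap L q v) = (∑ k : Fin K, momMap L q v k * v k) - L (q, v))
    (hconstr : ∀ (i : Fin R) q v, φ i (q, momMap L q v) = 0)
    (hmult : ∀ q v (k : Fin K),
      v k = fderiv ℝ Hr (q, momMap L q v) (0, Pi.single k 1)
        + ∑ i : Fin R, ω i (q, v) * fderiv ℝ (φ i) (q, momMap L q v) (0, Pi.single k 1)) :
    ∀ (q : Fin m → ℝ) (v : Fin K → ℝ) (j : Fin m),
      fderiv ℝ Hr (q, momMap L q v) (Pi.single j 1, 0) =
        - (∑ i : Fin R, ω i (q, v) * fderiv ℝ (φ i) (q, momMap L q v) (Pi.single j 1, 0))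
          - fderiv ℝ L (q, v) (Pi.single j 1, 0) := by
  intro q v j
  set e : Fin m → ℝ := Pi.single j 1
  obtain ⟨P', hP⟩ := differentiable_momMap_left hL v q
  set w := P' e
  have hchain (F : (Fin m → ℝ) × (Fin K → ℝ) → ℝ) (hF : ContDiff ℝ (⊤ : ℕ∞) F) :
      HasFDerivAt (fun x => F (x, momMap L x v))
        ((fderiv ℝ F (q, momMap L q v)).comp ((ContinuousLinearMap.id ℝ _).prod P')) q :=
    ((hF.differentiable (by simp)) (q, momMap L q v)).hasFDerivAt.comp q
      ((hasFDerivAt_id q).prodMk hP)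
  have hφ' (i : Fin R) : fderiv ℝ (φ i) (q, momMap L q v) (e, w) = 0 := by
    have h := hchain (φ i) (hφ i)
    simp only [hconstr] at h
    simpa using DFunLike.congr_fun (h.unique (hasFDerivAt_const 0 q)) e
  have hH' : fderiv ℝ Hr (q, momMap L q v) (e, w) =
      ∑ k, w k * v k - fderiv ℝ L (q, v) (e, 0) := by
    have h := hchain Hr hHr
    simp only [hHrL] at h
    have hL' : HasFDerivAt (fun x => L (x, v)) ((fderiv ℝ L (q, v)).comp
        ((ContinuousLinearMap.id ℝ _).prod 0)) q :=
      ((hL.differentiable (by simp)) (q, v)).hasFDerivAt.comp q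
        ((hasFDerivAt_id q).prodMk (hasFDerivAt_const v q))
    have hs := (HasFDerivAt.fun_sum fun k (_ : k ∈ Finset.univ) =>
      ((hasFDerivAt_pi'.1 hP k).mul_const (v k))).sub hL'
    simpa [w, mul_comm] using DFunLike.congr_fun (h.unique hs) e
  rw [clm_prod_apply_eq_add_sum] at hH'
  have hv : ∑ k, w k * v k =
      ∑ k, w k * fderiv ℝ Hr (q, momMap L q v) (0, Pi.single k 1)
        - ∑ i, ω i (q, v) * fderiv ℝ (φ i) (q, momMap L q v) (e, 0) := by
    have hφs (i : Fin R) : ∑ k, w k * fderiv ℝ (φ i) (q, momMap L q v) (0, Pi.single k 1) =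
        -fderiv ℝ (φ i) (q, momMap L q v) (e, 0) := by
      have h := hφ' i
      rw [clm_prod_apply_eq_add_sum] at h
      linarith
    calc ∑ k, w k * v k
        = ∑ k, w k * (fderiv ℝ Hr (q, momMap L q v) (0, Pi.single k 1)
            + ∑ i, ω i (q, v) * fderiv ℝ (φ i) (q, momMap L q v) (0, Pi.single k 1)) :=
          Finset.sum_congr rfl fun k _ => congrArg (w k * ·) (hmult q v k)
      _ = ∑ k, w k * fderiv ℝ Hr (q, momMap L q v) (0, Pi.single k 1)
            + ∑ i, ω i (q, v) *
              ∑ k, w k * fderiv ℝ (φ i) (q, momMap L q v) (0, Pi.single k 1) := by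
          simp only [mul_add, Finset.sum_add_distrib, Finset.mul_sum]
          rw [Finset.sum_comm]
          simp only [mul_left_comm]
      _ = _ := by
          simp only [hφs, mul_neg, Finset.sum_neg_distrib, sub_eq_add_neg]
  linarith
end
end

section
/- For every Q = (Q_{k,β}), every p = (p_{k,β}) ∈ ℝ^{K×N}, and every w = (w_k) ∈ ℝ^K (playing the role of the velocities Q̇_{k,N−1}), the following identity holds: Σ_k P_{k,0} 𝒬_{k,1}(Q) + Σ_k Σ_{σ=1}^{N−2} P_{k,σ} 𝒬_{k,σ+1}(Q) + Σ_k P_{k,N−1} w_k = Σ_k Σ_{β=1}^{N−1} p_{k,β−1} X_k^β(Q) + Σ_k p_{k,N−1} [ Σ_l Σ_{ρ=0}^{N−2} (∂X_k^{N−1}/∂Q_{l,ρ})(Q) 𝒬_{l,ρ+1}(Q) + Σ_l (∂X_k^{N−1}/∂Q_{l,N−1})(Q) w_l ]. Consequently the generalised Ostrogradsky canonical Hamiltonian built on the auxiliary variables Q coincides, under the canonical transformation generated by F₂, with the standard Ostrogradsky canonical Hamiltonian Σ p_{k,β−1} q_{k,β} + Σ p_{k,N−1} q̇_{k,N−1}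 − L; i.e. the Hamiltonian formulations developed from one and the same Lagrangian by different choices of auxiliary variables are canonically equivalent. -/
noncomputable section

/-- The transformed momenta of the generalised Ostrogradsky construction, i.e. the image
of the momenta `p` under the canonical transformation generated by the type-2 generating
function `F₂(Q,p) = Σ_k p_{k,0} Q_{k,0} + Σ_k Σ_{β=1}^{N−1} p_{k,β} X_k^β(Q)`:
`P_{k,0} := p_{k,0} + Σ_l Σ_{β'=1}^{N−1} (∂X_l^{β'}/∂Q_{k,0}) p_{l,β'}` and
`P_{k,β} := Σ_l Σ_{β'=1}^{N−1} (∂X_l^{β'}/∂Q_{k,β}) p_{l,β'}` for `1 ≤ β ≤ N−1`. -/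
def genOstroMom (N K : ℕ) (X : Fin K → ℕ → (Fin K → Fin N → ℝ) → ℝ)
    (Q : Fin K → Fin N → ℝ) (p : Fin K → Fin N → ℝ) (k : Fin K) (β : Fin N) : ℝ :=
  (if (β : ℕ) = 0 then p k β else 0)
    + ∑ l : Fin K, ∑ β' : Fin N,
        if 1 ≤ (β' : ℕ) then
          fderiv ℝ (X l (β' : ℕ)) Q (Pi.single k (Pi.single β 1)) * p l β'
        else 0

/-- A directional derivative vanishes along a direction in which the function is constant. -/
theorem fderiv_apply_eq_zero_of_forall_add_smul {E : Type*} [NormedAddCommGroup E]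
    [NormedSpace ℝ E] {f : E → ℝ} {x v : E} (hf : DifferentiableAt ℝ f x)
    (h : ∀ t : ℝ, f (x + t • v) = f x) : fderiv ℝ f x v = 0 := by
  rw [← hf.lineDeriv_eq_fderiv]
  simp [lineDeriv, h]

/-- Pairing the transformed momenta with a velocity `v` gives the pairing of the original momenta
with the derivatives along `v` of the functions `X k b`. -/
theorem sum_genOstroMom_mul (M K : ℕ) (X : Fin K → ℕ → (Fin K → Fin (M + 2) → ℝ) → ℝ)
    (Q p v : Fin K → Fin (M + 2) → ℝ) :
    ∑ k, ∑ σ, genOstroMom (M + 2) K X Q p k σ * v k σ =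
      ∑ k, (p k 0 * v k 0 + ∑ b : Fin (M + 1), p k b.succ *
        ∑ l, ∑ ρ, fderiv ℝ (X k (b + 1)) Q (Pi.single l (Pi.single ρ 1)) * v l ρ) := by
  simp only [genOstroMom, add_mul, Finset.sum_add_distrib]
  congr 1
  · refine Finset.sum_congr rfl fun k _ => ?_
    simp
  · simp only [Finset.sum_mul, Finset.mul_sum]
    simp_rw [Finset.sum_comm (s := (Finset.univ : Finset (Fin (M + 2))))
      (t := (Finset.univ : Finset (Fin K)))]
    rw [Finset.sum_comm]
    refine Finset.sum_congr rfl fun l _ => ?_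
    rw [Finset.sum_comm (s := (Finset.univ : Finset (Fin (M + 1))))]
    refine Finset.sum_congr rfl fun k _ => ?_
    rw [Finset.sum_comm, Fin.sum_univ_succ]
    simp only [Fin.val_zero, Fin.val_succ]
    simp [mul_comm, mul_left_comm]

/-- **Canonical equivalence of the generalised and standard Ostrogradsky Hamiltonian
formulations:** the kinetic part of the generalised canonical Hamiltonian, expressed via
the transformed momenta, coincides with the standard Ostrogradsky kinetic part. -/
theorem generalized_ostrogradsky_equivalence
    (N K : ℕ) (hN : 2 ≤ N) (hK : 1 ≤ K)
    (X : Fin K → ℕ → (Fin K → Fin N → ℝ) → ℝ)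
    (calQ : Fin K → ℕ → (Fin K → Fin N → ℝ) → ℝ)
    (hX : ∀ k (β : ℕ), 1 ≤ β → β ≤ N - 1 → ContDiff ℝ (⊤ : ℕ∞) (X k β))
    (hcalQ : ∀ k (β : ℕ), 1 ≤ β → β ≤ N - 1 → ContDiff ℝ (⊤ : ℕ∞) (calQ k β))
    (hXdep : ∀ (k : Fin K) (β : ℕ), 1 ≤ β → β ≤ N - 1 →
      ∀ Q Q' : Fin K → Fin N → ℝ,
        (∀ (l : Fin K) (ρ : Fin N), (ρ : ℕ) ≤ β → Q l ρ = Q' l ρ) → X k β Q = X k β Q')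
    (hrec1 : ∀ (k : Fin K) (Q : Fin K → Fin N → ℝ), X k 1 Q = calQ k 1 Q)
    (hrec : ∀ (k : Fin K) (σ : ℕ), 1 ≤ σ → σ ≤ N - 2 → ∀ Q : Fin K → Fin N → ℝ,
      X k (σ + 1) Q =
        ∑ l : Fin K, ∑ ρ : Fin N,
          if (ρ : ℕ) ≤ σ then
            fderiv ℝ (X k σ) Q (Pi.single l (Pi.single ρ 1)) * calQ l ((ρ : ℕ) + 1) Q
          else 0) :
    ∀ (Q p : Fin K → Fin N → ℝ) (w : Fin K → ℝ),
      (∑ k : Fin K, genOstroMom N K X Q p k ⟨0, by omega⟩ * calQ k 1 Q)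
        + (∑ k : Fin K, ∑ σ : Fin N,
            if 1 ≤ (σ : ℕ) ∧ (σ : ℕ) ≤ N - 2 then
              genOstroMom N K X Q p k σ * calQ k ((σ : ℕ) + 1) Q
            else 0)
        + (∑ k : Fin K, genOstroMom N K X Q p k ⟨N - 1, by omega⟩ * w k)
      = (∑ k : Fin K, ∑ β : Fin N,
            if 1 ≤ (β : ℕ) then
              p k ⟨(β : ℕ) - 1, lt_of_le_of_lt (Nat.sub_le _ _) β.isLt⟩ * X k (β : ℕ) Q
            else 0)
        + ∑ k : Fin K,
            p k ⟨N - 1, by omega⟩ *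
              ((∑ l : Fin K, ∑ ρ : Fin N,
                  if (ρ : ℕ) ≤ N - 2 then
                    fderiv ℝ (X k (N - 1)) Q (Pi.single l (Pi.single ρ 1)) *
                      calQ l ((ρ : ℕ) + 1) Q
                  else 0)
                + ∑ l : Fin K,
                    fderiv ℝ (X k (N - 1)) Q
                        (Pi.single l (Pi.single (⟨N - 1, by omega⟩ : Fin N) 1)) * w l) := by
  obtain ⟨M, rfl⟩ : ∃ M, N = M + 2 := ⟨N - 2, by omega⟩
  intro Q p w
  have hzero : ∀ (k : Fin K) (β : ℕ), 1 ≤ β → β ≤ M + 1 → ∀ (l : Fin K) (ρ : Fin (M + 2)),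
      β < (ρ : ℕ) → fderiv ℝ (X k β) Q (Pi.single l (Pi.single ρ 1)) = 0 := by
    intro k β h1 h2 l ρ hρ
    refine fderiv_apply_eq_zero_of_forall_add_smul
      ((hX k β h1 h2).differentiable (by simp)).differentiableAt fun t => ?_
    refine hXdep k β h1 h2 _ _ fun l' ρ' hρ' => ?_
    have hne : ρ' ≠ ρ := by rintro rfl; omega
    by_cases hl : l' = l
    · subst hl
      simp [hne]
    · simp [hl]
  let v : Fin K → Fin (M + 2) → ℝ :=
    fun k => Fin.snoc (fun σ : Fin (M + 1) => calQ k ((σ : ℕ) + 1) Q) (w k)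
  have hvc : ∀ k (σ : Fin (M + 1)), v k σ.castSucc = calQ k ((σ : ℕ) + 1) Q := fun k σ => by
    simp [v]
  have hvl : ∀ k, v k (Fin.last (M + 1)) = w k := fun k => by simp [v]
  have hv0 : ∀ k, v k 0 = X k 1 Q := fun k => by
    rw [hrec1]
    exact hvc k 0
  have hlast : (⟨M + 2 - 1, by omega⟩ : Fin (M + 2)) = Fin.last (M + 1) := rfl
  have hleft := sum_genOstroMom_mul M K X Q p v
  have htotal : ∀ (k : Fin K) (b : Fin M),
      ∑ l, ∑ ρ, fderiv ℝ (X k ((b : ℕ) + 1)) Q (Pi.single l (Pi.single ρ 1)) * v l ρ =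
        X k ((b : ℕ) + 2) Q := by
    intro k b
    rw [hrec k (b + 1) (by omega) (by omega) Q]
    refine Finset.sum_congr rfl fun l _ => Finset.sum_congr rfl fun ρ _ => ?_
    split_ifs with h
    · have := hvc l ⟨ρ, by omega⟩
      rw [← this]
      rfl
    · rw [hzero k _ (by omega) (by omega) l ρ (by omega), zero_mul]
  trans ∑ k, ∑ σ, genOstroMom (M + 2) K X Q p k σ * v k σ
  · rw [← Finset.sum_add_distrib, ← Finset.sum_add_distrib]
    refine Finset.sum_congr rfl fun k _ => ?_
    have hmid : ∀ i : Fin M, (i : ℕ) + 1 ≤ M := fun i => i.isLt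
    have hsplit : ∀ f : Fin (M + 2) → ℝ,
        ∑ σ, f σ = f 0 + ∑ i : Fin M, f i.succ.castSucc + f (Fin.last (M + 1)) := fun f => by
      rw [Fin.sum_univ_castSucc, Fin.sum_univ_succ]
      rfl
    rw [hsplit, hsplit]
    simp only [hvc, hvl, hv0, hrec1, hlast]
    simp [hmid]
  · rw [hleft, ← Finset.sum_add_distrib]
    refine Finset.sum_congr rfl fun k _ => ?_
    have hle : ∀ i : Fin (M + 1), (i : ℕ) ≤ M := fun i => Nat.lt_succ_iff.mp i.isLt
    have hbracket :
        ∑ l, ∑ ρ, fderiv ℝ (X k (M + 1)) Q (Pi.single l (Pi.single ρ 1)) * v l ρ =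
          (∑ l, ∑ ρ : Fin (M + 2), if (ρ : ℕ) ≤ M then
            fderiv ℝ (X k (M + 1)) Q (Pi.single l (Pi.single ρ 1)) * calQ l ((ρ : ℕ) + 1) Q
            else 0) +
          ∑ l, fderiv ℝ (X k (M + 1)) Q
            (Pi.single l (Pi.single (Fin.last (M + 1)) 1)) * w l := by
      rw [← Finset.sum_add_distrib]
      refine Finset.sum_congr rfl fun l _ => ?_
      have hsplit : ∀ f : Fin (M + 2) → ℝ,
          ∑ ρ, f ρ = ∑ i : Fin (M + 1), f i.castSucc + f (Fin.last (M + 1)) :=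
        Fin.sum_univ_castSucc
      rw [hsplit, hsplit]
      simp [hvc, hvl, hle]
    rw [Fin.sum_univ_castSucc, Fin.sum_univ_succ (n := M + 1), Fin.sum_univ_succ (n := M), hv0]
    simp only [Fin.val_castSucc, htotal, Fin.val_last, hbracket]
    simp [add_assoc]
    rfl
end
end

section
/- If the real numbers p₁, p₂, p₃ satisfy the Kasner conditions p₁ + p₂ + p₃ = 1 and p₁² + p₂² + p₃² = 1, then the characteristic polynomial of the 9×9 matrix M(p₁,p₂,p₃) is det(λ I₉ − M(p₁,p₂,p₃)) = λ² (λ + 1)(λ − 2)⁵ (λ − 3). -/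
noncomputable section

def f1 (p₁ p₂ p₃ : ℝ) : ℝ :=
  (2 * p₁ ^ 2 - 2 * p₁ * p₂ - 2 * p₁ * p₃ + 3 * p₁ + p₂ ^ 2 + p₂ + p₃ ^ 2 + p₃ - 2) *
    (p₁ + p₂ + p₃ - 3)

def f2 (p₁ p₂ p₃ : ℝ) : ℝ :=
  -p₁ * (4 * p₂ + 4 * p₃ - 9) - p₂ * (2 * p₃ - 7) + p₁ ^ 2 + 7 * p₃ - 11

def f3 (p₁ p₂ p₃ : ℝ) : ℝ := -(2 * p₁ + 2 * p₂ + 2 * p₃ - 6)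

def f4 (p₁ p₂ p₃ : ℝ) : ℝ :=
  (2 * p₂ * (p₃ - 2) + 3 * p₂ ^ 2 + p₃ ^ 2 + 2 * p₃ - 5) * p₁
    - p₁ ^ 2 * (p₂ + 2 * p₃ - 5) - p₂ * (p₃ ^ 2 + 1) - 2 * p₂ ^ 3 + 3 * p₂ ^ 2

def f5 (p₁ p₂ p₃ : ℝ) : ℝ := p₁ * (2 * p₂ + 1) - p₁ ^ 2 - p₂ ^ 2 + p₂

def f6 (_ _ _ : ℝ) : ℝ := 0

def f7 (p₁ p₂ p₃ : ℝ) : ℝ :=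
  p₁ * (2 * p₂ * (p₃ + 1) + p₂ ^ 2 + 3 * p₃ ^ 2 - 4 * p₃ - 5)
    - p₁ ^ 2 * (2 * p₂ + p₃ - 5) - p₂ ^ 2 * p₃ - 2 * p₃ ^ 3 + 3 * p₃ ^ 2 - p₃

def f8 (p₁ p₂ p₃ : ℝ) : ℝ := p₁ * (2 * p₃ + 1) - p₁ ^ 2 - p₃ ^ 2 + p₃

def f9 (_ _ _ : ℝ) : ℝ := 0

/-- The functions `f₁,…,f₉` collected as a vector. -/
def fvec : Fin 9 → ℝ → ℝ → ℝ → ℝ := ![f1, f2, f3, f4, f5, f6, f7, f8, f9]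

/-- The 9×9 matrix of the linearised Riemann-squared mixmaster perturbation system. -/
def mixmasterMatrix (p₁ p₂ p₃ : ℝ) : Matrix (Fin 9) (Fin 9) ℝ :=
  Matrix.of fun i j =>
    if i = 0 then (if j = 1 then 1 else 0)
    else if i = 1 then (if j = 2 then 1 else 0)
    else if i = 2 then fvec j p₁ p₂ p₃
    else if i = 3 then (if j = 4 then 1 else 0)
    else if i = 4 then (if j = 5 then 1 else 0)
    else if i = 5 then
      (if h : (j : ℕ) < 3 then fvec ⟨(j : ℕ) + 6, by omega⟩ p₂ p₃ p₁
       else fvec ⟨(j : ℕ) - 3, lt_of_le_of_lt (Nat.sub_le _ _) j.isLt⟩ p₂ p₃ p₁)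
    else if i = 6 then (if j = 7 then 1 else 0)
    else if i = 7 then (if j = 8 then 1 else 0)
    else
      (if h : (j : ℕ) < 6 then fvec ⟨(j : ℕ) + 3, by omega⟩ p₃ p₁ p₂
       else fvec ⟨(j : ℕ) - 6, lt_of_le_of_lt (Nat.sub_le _ _) j.isLt⟩ p₃ p₁ p₂)

/-- On the Kasner circle the coefficient functions become quadratic. -/
theorem coeffs_of_kasner {p q r : ℝ} (h1 : p + q + r = 1) (h2 : p ^ 2 + q ^ 2 + r ^ 2 = 1) :
    f1 p q r = -6 * (p * p) ∧ f2 p q r = 3 * (p * p) - 4 ∧ f3 p q r = 4 ∧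
      f4 p q r = -6 * (p * q) ∧ f5 p q r = 3 * (p * q) ∧
      f7 p q r = -6 * (p * r) ∧ f8 p q r = 3 * (p * r) := by
  obtain rfl : r = 1 - p - q := by linarith
  have h : q ^ 2 = p + q - p * q - p ^ 2 := by linarith
  have h' : q ^ 3 = q * (p + q - p * q - p ^ 2) := by rw [← h]; ring
  simp only [f1, f2, f3, f4, f5, f7, f8]
  refine ⟨?_, ?_, ?_, ?_, ?_, ?_, ?_⟩ <;> ring_nf <;> simp only [h, h'] <;> ring_nf <;>
    simp only [h] <;> ring

open Polynomial in
/-- The companion matrix whose image under `X ↦ p pᵀ` is `lam • 1 - M` at a Kasner point. -/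
def companionPoly (lam : ℝ) : Matrix (Fin 3) (Fin 3) ℝ[X] :=
  !![C lam, -1, 0; 0, C lam, -1; C 6 * X, C 4 - C 3 * X, C (lam - 4)]

open Polynomial in
theorem det_companionPoly (lam : ℝ) :
    (companionPoly lam).det = C (lam - 2) * (C (lam ^ 2 - 2 * lam) - C 3 * X) := by
  simp only [companionPoly, Matrix.det_fin_three, Matrix.of_apply, Matrix.cons_val,
    map_sub, map_mul, map_pow, map_ofNat]
  ring

theorem det_aeval_vecMulVec (v : Fin 3 → ℝ) (lam : ℝ) :
    ((Polynomial.aeval (Matrix.vecMulVec v v)) (companionPoly lam).det).det =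
      (lam - 2) ^ 3 * (lam ^ 2 - 2 * lam) ^ 2 *
        (lam ^ 2 - 2 * lam - 3 * (v 0 ^ 2 + v 1 ^ 2 + v 2 ^ 2)) := by
  rw [det_companionPoly]
  simp [Algebra.algebraMap_eq_smul_one, -map_sub, Matrix.det_fin_three, Matrix.vecMulVec_apply,
    sub_mul]
  ring

set_option maxHeartbeats 2000000 in
/-- At a Kasner point `lam • 1 - M` is, up to reindexing, the block matrix obtained from
`companionPoly lam` by substituting the rank-one matrix `p pᵀ` for `X`. -/
theorem smul_one_sub_mixmasterMatrix {p₁ p₂ p₃ : ℝ}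
    (h1 : p₁ + p₂ + p₃ = 1) (h2 : p₁ ^ 2 + p₂ ^ 2 + p₃ ^ 2 = 1) (lam : ℝ) :
    (lam • (1 : Matrix (Fin 9) (Fin 9) ℝ) - mixmasterMatrix p₁ p₂ p₃) =
      (Matrix.comp (Fin 3) (Fin 3) (Fin 3) (Fin 3) ℝ
        ((companionPoly lam).map
          (Polynomial.aeval (Matrix.vecMulVec ![p₁, p₂, p₃] ![p₁, p₂, p₃])))).submatrix
        (finProdFinEquiv.symm.trans (Equiv.prodComm (Fin 3) (Fin 3)))
        (finProdFinEquiv.symm.trans (Equiv.prodComm (Fin 3) (Fin 3))) := by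
  obtain ⟨a1, a2, a3, a4, a5, a7, a8⟩ := coeffs_of_kasner h1 h2
  obtain ⟨b1, b2, b3, b4, b5, b7, b8⟩ :=
    coeffs_of_kasner (p := p₂) (q := p₃) (r := p₁) (by linarith) (by linarith)
  obtain ⟨c1, c2, c3, c4, c5, c7, c8⟩ :=
    coeffs_of_kasner (p := p₃) (q := p₁) (r := p₂) (by linarith) (by linarith)
  ext i j
  obtain ⟨⟨k, a⟩, rfl⟩ := (finProdFinEquiv (m := 3) (n := 3)).surjective i
  obtain ⟨⟨l, b⟩, rfl⟩ := (finProdFinEquiv (m := 3) (n := 3)).surjective j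
  rw [Matrix.submatrix_apply]
  simp only [Equiv.trans_apply, Equiv.symm_apply_apply, Equiv.prodComm_apply, Prod.swap_prod_mk,
    Matrix.comp_apply, Matrix.map_apply]
  fin_cases a <;> fin_cases b <;>
    simp [companionPoly, Algebra.algebraMap_eq_smul_one, -map_sub] <;>
    fin_cases k <;> fin_cases l <;>
    simp [mixmasterMatrix, fvec, finProdFinEquiv, f6, f9, *]

/-- **Characteristic polynomial of the linearised mixmaster system at a Kasner point.** -/
theorem kasner_mixmaster_charpoly (p₁ p₂ p₃ : ℝ)
    (h1 : p₁ + p₂ + p₃ = 1) (h2 : p₁ ^ 2 + p₂ ^ 2 + p₃ ^ 2 = 1) :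
    ∀ lam : ℝ,
      Matrix.det (lam • (1 : Matrix (Fin 9) (Fin 9) ℝ) - mixmasterMatrix p₁ p₂ p₃) =
        lam ^ 2 * (lam + 1) * (lam - 2) ^ 5 * (lam - 3) := by
  intro lam
  rw [smul_one_sub_mixmasterMatrix h1 h2, Matrix.det_submatrix_equiv_self]
  refine (Matrix.det_det (companionPoly lam) (Polynomial.aeval
    (Matrix.vecMulVec ![p₁, p₂, p₃] ![p₁, p₂, p₃])).toRingHom).symm.trans ?_
  refine (det_aeval_vecMulVec ![p₁, p₂, p₃] lam).trans ?_
  simp only [Matrix.cons_val]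
  rw [h2]
  ring
end
end

section
/- For the isotropic values p₁ = p₂ = p₃ = 1/2, the characteristic polynomial of the 9×9 matrix M(1/2,1/2,1/2) is det(λ I₉ − M(1/2,1/2,1/2)) = (1/64)(2λ − 1)²(2λ − 3)³(2λ − 5)(λ + 1)(λ − 1)². -/
noncomputable section

theorem mixmasterMatrix_isotropic :
    mixmasterMatrix (1/2) (1/2) (1/2) =
      !![0, 1, 0, 0, 0, 0, 0, 0, 0;
         0, 0, 1, 0, 0, 0, 0, 0, 0;
         -3/4, -7/4, 3, -3/2, 1, 0, -3/2, 1, 0;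
         0, 0, 0, 0, 1, 0, 0, 0, 0;
         0, 0, 0, 0, 0, 1, 0, 0, 0;
         -3/2, 1, 0, -3/4, -7/4, 3, -3/2, 1, 0;
         0, 0, 0, 0, 0, 0, 0, 1, 0;
         0, 0, 0, 0, 0, 0, 0, 0, 1;
         -3/2, 1, 0, -3/2, 1, 0, -3/4, -7/4, 3] := by
  have h₁ : f1 (1/2) (1/2) (1/2) = -3/4 := by norm_num [f1]
  have h₂ : f2 (1/2) (1/2) (1/2) = -7/4 := by norm_num [f2]
  have h₃ : f3 (1/2) (1/2) (1/2) = 3 := by norm_num [f3]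
  have h₄ : f4 (1/2) (1/2) (1/2) = -3/2 := by norm_num [f4]
  have h₅ : f5 (1/2) (1/2) (1/2) = 1 := by norm_num [f5]
  have h₇ : f7 (1/2) (1/2) (1/2) = -3/2 := by norm_num [f7]
  have h₈ : f8 (1/2) (1/2) (1/2) = 1 := by norm_num [f8]
  ext i j
  fin_cases i <;> fin_cases j <;>
    simp [mixmasterMatrix, fvec, f6, f9, h₁, h₂, h₃, h₄, h₅, h₇, h₈, -one_div]

/-- A basis of eigenvectors of `mixmasterMatrix (1/2) (1/2) (1/2)`, as columns. -/
def isotropicEigenbasis : Matrix (Fin 9) (Fin 9) ℝ :=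
  !![1, 1, 1, 1, 0, 1, 0, 1, 0;
     3/2, 5/2, -1, 1/2, 0, 3/2, 0, 1, 0;
     9/4, 25/4, 1, 1/4, 0, 9/4, 0, 1, 0;
     1, 1, 1, -1, 1, -1, 1, -1, 1;
     3/2, 5/2, -1, -1/2, 1/2, -3/2, 3/2, -1, 1;
     9/4, 25/4, 1, -1/4, 1/4, -9/4, 9/4, -1, 1;
     1, 1, 1, 0, -1, 0, -1, 0, -1;
     3/2, 5/2, -1, 0, -1/2, 0, -3/2, 0, -1;
     9/4, 25/4, 1, 0, -1/4, 0, -9/4, 0, -1]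

/-- The inverse of `isotropicEigenbasis`. -/
def isotropicEigenbasisInv : Matrix (Fin 9) (Fin 9) ℝ :=
  !![1/3, 1/5, -2/15, 1/3, 1/5, -2/15, 1/3, 1/5, -2/15;
     -1/7, -1/21, 2/21, -1/7, -1/21, 2/21, -1/7, -1/21, 2/21;
     1/7, -16/105, 4/105, 1/7, -16/105, 4/105, 1/7, -16/105, 4/105;
     2, -10/3, 4/3, -1, 5/3, -2/3, -1, 5/3, -2/3;
     1, -5/3, 2/3, 1, -5/3, 2/3, -2, 10/3, -4/3;
     2/3, -2, 4/3, -1/3, 1, -2/3, -1/3, 1, -2/3;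
     1/3, -1, 2/3, 1/3, -1, 2/3, -2/3, 2, -4/3;
     -2, 16/3, -8/3, 1, -8/3, 4/3, 1, -8/3, 4/3;
     -1, 8/3, -4/3, -1, 8/3, -4/3, 2, -16/3, 8/3]

/-- The eigenvalues belonging to the columns of `isotropicEigenbasis`. -/
def isotropicEigenvalues : Fin 9 → ℝ :=
  ![3/2, 5/2, -1, 1/2, 1/2, 3/2, 3/2, 1, 1]

set_option maxHeartbeats 1000000 in
theorem isotropicEigenbasis_mul_inv :
    isotropicEigenbasis * isotropicEigenbasisInv = 1 := by
  ext i j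
  fin_cases i <;> fin_cases j <;>
    norm_num [isotropicEigenbasis, isotropicEigenbasisInv, Matrix.mul_apply, Fin.sum_univ_succ]

theorem mixmasterMatrix_mul_isotropicEigenbasis :
    mixmasterMatrix (1/2) (1/2) (1/2) * isotropicEigenbasis =
      isotropicEigenbasis * Matrix.diagonal isotropicEigenvalues := by
  rw [mixmasterMatrix_isotropic]
  ext i j
  rw [Matrix.mul_diagonal]
  fin_cases i <;> fin_cases j <;>
    norm_num [isotropicEigenbasis, isotropicEigenvalues, Matrix.mul_apply, Fin.sum_univ_succ]

/-- A matrix `M` with `M * P = P * diagonal d` for an invertible `P` has characteristic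
polynomial `∏ i, (x - d i)`. -/
theorem det_smul_one_sub_of_mul_eq_mul_diagonal {n R : Type*} [Fintype n] [DecidableEq n]
    [CommRing R] {M P Q : Matrix n n R} {d : n → R} (hPQ : P * Q = 1)
    (hMP : M * P = P * Matrix.diagonal d) (x : R) :
    (x • (1 : Matrix n n R) - M).det = ∏ i, (x - d i) := by
  have hM : x • (1 : Matrix n n R) - M = P * Matrix.diagonal (fun i => x - d i) * Q := by
    have hdiag : Matrix.diagonal (fun i => x - d i) =
        x • (1 : Matrix n n R) - Matrix.diagonal d := by
      rw [Matrix.smul_one_eq_diagonal, Matrix.diagonal_sub]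
    rw [hdiag, mul_sub, ← hMP, sub_mul, mul_assoc M, hPQ, mul_smul_comm, smul_mul_assoc,
      mul_one, hPQ, mul_one]
  have hdet : P.det * Q.det = 1 := by rw [← Matrix.det_mul, hPQ, Matrix.det_one]
  rw [hM, Matrix.det_mul, Matrix.det_mul, Matrix.det_diagonal, mul_right_comm, hdet, one_mul]

/-- **Characteristic polynomial of the linearised mixmaster system at the isotropic
point `p₁ = p₂ = p₃ = 1/2`.** -/
theorem isotropic_mixmaster_charpoly :
    ∀ lam : ℝ,
      Matrix.det (lam • (1 : Matrix (Fin 9) (Fin 9) ℝ)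
          - mixmasterMatrix (1/2) (1/2) (1/2)) =
        1 / 64 * (2 * lam - 1) ^ 2 * (2 * lam - 3) ^ 3 * (2 * lam - 5) *
          (lam + 1) * (lam - 1) ^ 2 := by
  intro lam
  rw [det_smul_one_sub_of_mul_eq_mul_diagonal isotropicEigenbasis_mul_inv
    mixmasterMatrix_mul_isotropicEigenbasis]
  simp [isotropicEigenvalues, Fin.prod_univ_succ]
  ring
end
end

section
/- If the functions μ, β₊, β₋, K°, Π_μ, Π₊, Π₋, 𝔭° satisfy the pure R²-gravity class-A Bianchi canonical equations and the super-Hamiltonian constraint 𝓗(t) = 0 holds for all t, then the quantity Π_μ(t) − K°(t) 𝔭°(t) is constant (it is a first integral of the canonical system). -/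
noncomputable section

/-- **Pure `R²`-gravity class-A Bianchi canonical system: first integral.**
If the canonical equations hold and the super-Hamiltonian constraint vanishes
identically, then `Π_μ - K° 𝔭°` is constant. -/
theorem r2_classA_first_integral
    (N : ℝ → ℝ) (hN : Continuous N)
    (V : ℝ → ℝ → ℝ) (hV : ContDiff ℝ (⊤ : ℕ∞) (fun p : ℝ × ℝ => V p.1 p.2))
    (μ βp βm K0 PiMu PiP PiM P0 : ℝ → ℝ)
    (hP0ne : ∀ t, P0 t ≠ 0)
    (hμ : ∀ t, HasDerivAt μ (-(Real.sqrt 3 / 3) * N t * K0 t) t)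
    (hβp : ∀ t, HasDerivAt βp (-(Real.sqrt 3 / 6) * N t * PiP t / P0 t) t)
    (hβm : ∀ t, HasDerivAt βm (-(Real.sqrt 3 / 6) * N t * PiM t / P0 t) t)
    (hK0 : ∀ t, HasDerivAt K0
      (N t * (Real.sqrt 3 / 3 *
            (2 * (K0 t) ^ 2 + ((PiP t) ^ 2 + (PiM t) ^ 2) / (4 * (P0 t) ^ 2))
        + 1 / 3 * P0 t * Real.exp (-(3 * μ t))
        - Real.sqrt 3 / 12 * Real.exp (-(2 * μ t)) * V (βp t) (βm t))) t)
    (hPiMu : ∀ t, HasDerivAt PiMu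
      (N t * (1 / 2 * (P0 t) ^ 2 * Real.exp (-(3 * μ t))
        - Real.sqrt 3 / 6 * P0 t * Real.exp (-(2 * μ t)) * V (βp t) (βm t))) t)
    (hPiP : ∀ t, HasDerivAt PiP
      (1 / 4 * N t * P0 t * Real.exp (-(2 * μ t)) * deriv (fun u => V u (βm t)) (βp t)) t)
    (hPiM : ∀ t, HasDerivAt PiM
      (1 / 4 * N t * P0 t * Real.exp (-(2 * μ t)) * deriv (fun u => V (βp t) u) (βm t)) t)
    (hP0 : ∀ t, HasDerivAt P0 (-(Real.sqrt 3 / 3) * N t * (4 * K0 t * P0 t - PiMu t)) t)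
    (hcon : ∀ t,
      Real.sqrt 3 / 3 *
          (2 * P0 t * (K0 t) ^ 2 - K0 t * PiMu t - ((PiP t) ^ 2 + (PiM t) ^ 2) / (4 * P0 t))
        + 1 / 6 * Real.exp (-(3 * μ t)) * (P0 t) ^ 2
        - Real.sqrt 3 / 12 * Real.exp (-(2 * μ t)) * P0 t * V (βp t) (βm t) = 0) :
    ∀ s t, PiMu s - K0 s * P0 s = PiMu t - K0 t * P0 t := by
  have hderiv : ∀ t, HasDerivAt (fun x => PiMu x - K0 x * P0 x) 0 t := fun t => by
    refine ((hPiMu t).sub ((hK0 t).mul (hP0 t))).congr_deriv ?_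
    have hS : ((PiP t) ^ 2 + (PiM t) ^ 2) / (4 * (P0 t) ^ 2) * P0 t
        = ((PiP t) ^ 2 + (PiM t) ^ 2) / (4 * P0 t) := by
      field_simp [hP0ne t]
    linear_combination N t * hcon t - N t * (Real.sqrt 3 / 3) * hS
  exact is_const_of_deriv_eq_zero (fun t => (hderiv t).differentiableAt)
    (fun t => (hderiv t).deriv)
end
end

section
/- Let 𝓀 ≠ 0, ρ ≠ 0, ω ≠ 0 and n ≠ 0 be real constants, and let I ⊆ ℝ be an interval on which n e^{2ωt} ≠ 1 and (64 𝓀² ω²/(27 ρ³)) · n e^{2ωt}/(1 − n e^{2ωt})² > 0. Then the functions μ(t) := (1/3) log[(64 𝓀² ω²/(27 ρ³)) · n e^{2ωt}/(1 − n e^{2ωt})²] and Π_μ(t) := (𝓀 ω/3)(1 + n e^{2ωt})/(1 − n e^{2ωt}) satisfy the Bianchi-type I reduced R²-gravity canonical equations μ̇ = (2/𝓀) Π_μ and Π̇_μ = (9ρ³/(16𝓀)) e^{3μ} on I. -/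
noncomputable section

/-- **Bianchi-type I reduced `R²`-gravity canonical system: an explicit exact solution.**
For nonzero constants `𝓀, ρ, ω, n` and an interval `I` on which `n e^{2ωt} ≠ 1` and the
argument of the logarithm is positive, the stated functions `μ, Π_μ` solve the reduced
canonical equations `μ̇ = (2/𝓀) Π_μ` and `Π̇_μ = (9ρ³/(16𝓀)) e^{3μ}` on `I`. -/
theorem bianchiI_r2_exact_solution
    (kk ρ ω n : ℝ) (hk : kk ≠ 0) (hρ : ρ ≠ 0) (hω : ω ≠ 0) (hn : n ≠ 0)
    (I : Set ℝ) (hI : I.OrdConnected)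
    (h1 : ∀ t ∈ I, n * Real.exp (2 * ω * t) ≠ 1)
    (h2 : ∀ t ∈ I,
      0 < 64 * kk ^ 2 * ω ^ 2 / (27 * ρ ^ 3) *
        (n * Real.exp (2 * ω * t) / (1 - n * Real.exp (2 * ω * t)) ^ 2)) :
    ∀ t ∈ I,
      HasDerivAt
        (fun s => (1 / 3) * Real.log (64 * kk ^ 2 * ω ^ 2 / (27 * ρ ^ 3) *
          (n * Real.exp (2 * ω * s) / (1 - n * Real.exp (2 * ω * s)) ^ 2)))
        ((2 / kk) *
          (kk * ω / 3 * (1 + n * Real.exp (2 * ω * t)) / (1 - n * Real.exp (2 * ω * t)))) t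
      ∧
      HasDerivAt
        (fun s => kk * ω / 3 * (1 + n * Real.exp (2 * ω * s)) / (1 - n * Real.exp (2 * ω * s)))
        ((9 * ρ ^ 3 / (16 * kk)) *
          Real.exp (3 * ((1 / 3) * Real.log (64 * kk ^ 2 * ω ^ 2 / (27 * ρ ^ 3) *
            (n * Real.exp (2 * ω * t) / (1 - n * Real.exp (2 * ω * t)) ^ 2))))) t := by
  intro t ht
  have hne : 1 - n * Real.exp (2 * ω * t) ≠ 0 := sub_ne_zero.mpr (h1 t ht).symm
  have hpos := h2 t ht
  have hu : HasDerivAt (fun s => n * Real.exp (2 * ω * s))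
      (n * (Real.exp (2 * ω * t) * (2 * ω * 1))) t :=
    (((hasDerivAt_id t).const_mul (2 * ω)).exp).const_mul n
  have hexp : Real.exp (2 * ω * t) ≠ 0 := Real.exp_ne_zero _
  constructor
  · have h := ((((hu.fun_div ((hu.const_sub 1).fun_pow 2) (pow_ne_zero 2 hne)).const_mul
      (64 * kk ^ 2 * ω ^ 2 / (27 * ρ ^ 3))).log hpos.ne').const_mul (1 / 3))
    refine h.congr_deriv ?_
    generalize Real.exp (2 * ω * t) = e at *
    field_simp
    ring
  · have h := ((hu.const_add 1).const_mul (kk * ω / 3)).fun_div (hu.const_sub 1) hne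
    refine h.congr_deriv ?_
    rw [← mul_assoc 3 (1 / 3 : ℝ), mul_one_div_cancel three_ne_zero, one_mul, Real.exp_log hpos]
    generalize Real.exp (2 * ω * t) = e at *
    field_simp
    ring
end
end

section
/- If the functions A, K°, Π_A, 𝔭° satisfy the closed-FLRW R²-gravity canonical equations and the super-Hamiltonian constraint 𝓗(t) = 0 holds for all t, then the quantity A(t) Π_A(t) + K°(t) 𝔭°(t) is constant (it is a first integral of the canonical system). -/
noncomputable section

/-- **Closed-FLRW `R²`-gravity canonical system: first integral.**
If the canonical equations hold and the super-Hamiltonian constraint vanishes identically,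
then `A Π_A + K° 𝔭°` is constant. -/
theorem closed_flrw_r2_first_integral
    (N A K0 PiA P0 : ℝ → ℝ) (hN : Continuous N) (hAne : ∀ t, A t ≠ 0)
    (hA : ∀ t, HasDerivAt A (-(Real.sqrt 3 / 3) * N t * K0 t / A t) t)
    (hK0 : ∀ t, HasDerivAt K0 (N t * (1 / 3 * A t * P0 t + Real.sqrt 3)) t)
    (hPiA : ∀ t, HasDerivAt PiA
      (-(N t * (1 / 6 * (P0 t) ^ 2 + Real.sqrt 3 / 3 * K0 t * PiA t / (A t) ^ 2))) t)
    (hP0 : ∀ t, HasDerivAt P0 (Real.sqrt 3 / 3 * N t * PiA t / A t) t)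
    (hcon : ∀ t,
      Real.sqrt 3 * P0 t - Real.sqrt 3 / 3 * K0 t * PiA t / A t
        + 1 / 6 * A t * (P0 t) ^ 2 = 0) :
    ∀ s t, A s * PiA s + K0 s * P0 s = A t * PiA t + K0 t * P0 t := by
  have hderiv : ∀ t, HasDerivAt (fun t => A t * PiA t + K0 t * P0 t) 0 t := by
    intro t
    have hA0 := hAne t
    refine (((hA t).mul (hPiA t)).add ((hK0 t).mul (hP0 t))).congr_deriv ?_
    rw [← mul_zero (N t), ← hcon t]
    field_simp
    ring
  exact is_const_of_deriv_eq_zero (fun t => (hderiv t).differentiableAt)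
    (fun t => (hderiv t).deriv)
end
end

section
/- If the functions A, K°, Π_A, 𝔭° satisfy the Einstein–de Sitter R²-gravity canonical equations and the super-Hamiltonian constraint 𝓗(t) = 0 holds for all t, then both quantities Π_A(t)/A(t)² and A(t) Π_A(t) + K°(t) 𝔭°(t) are constant (the system possesses these two first integrals). -/
noncomputable section

/-- **Einstein–de Sitter `R²`-gravity canonical system: two first integrals.**
If the canonical equations hold and the super-Hamiltonian constraint vanishes identically,
then both `Π_A/A²` and `A Π_A + K° 𝔭°` are constant. -/
theorem eds_r2_first_integrals
    (N A K0 PiA P0 : ℝ → ℝ) (hN : Continuous N) (hAne : ∀ t, A t ≠ 0)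
    (hA : ∀ t, HasDerivAt A (-(Real.sqrt 3 / 3) * N t * K0 t / A t) t)
    (hK0 : ∀ t, HasDerivAt K0 (1 / 3 * N t * A t * P0 t) t)
    (hPiA : ∀ t, HasDerivAt PiA
      (-(N t * (1 / 6 * (P0 t) ^ 2 + Real.sqrt 3 / 3 * K0 t * PiA t / (A t) ^ 2))) t)
    (hP0 : ∀ t, HasDerivAt P0 (Real.sqrt 3 / 3 * N t * PiA t / A t) t)
    (hcon : ∀ t,
      1 / 6 * A t * (P0 t) ^ 2 - Real.sqrt 3 / 3 * K0 t * PiA t / A t = 0) :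
    (∀ s t, PiA s / (A s) ^ 2 = PiA t / (A t) ^ 2) ∧
    (∀ s t, A s * PiA s + K0 s * P0 s = A t * PiA t + K0 t * P0 t) := by
  have const_of_hasDerivAt_zero : ∀ f : ℝ → ℝ, (∀ t, HasDerivAt f 0 t) → ∀ s t, f s = f t :=
    fun f hf => is_const_of_deriv_eq_zero (fun t => (hf t).differentiableAt) fun t => (hf t).deriv
  have hsq : ∀ t, 1 / 6 * (P0 t) ^ 2 = Real.sqrt 3 / 3 * K0 t * PiA t / (A t) ^ 2 := by
    intro t
    have hne := hAne t
    have h := hcon t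
    field_simp at h ⊢
    linear_combination h
  constructor
  · refine const_of_hasDerivAt_zero (fun t => PiA t / (A t) ^ 2) fun t => ?_
    have hne := hAne t
    refine ((hPiA t).div ((hA t).pow 2) (pow_ne_zero 2 hne)).congr_deriv ?_
    rw [hsq t]
    simp only [Pi.pow_apply]
    field_simp
    ring
  · refine const_of_hasDerivAt_zero (fun t => A t * PiA t + K0 t * P0 t) fun t => ?_
    have hne := hAne t
    refine (((hA t).mul (hPiA t)).add ((hK0 t).mul (hP0 t))).congr_deriv ?_
    have hP : (P0 t) ^ 2 = 6 * (Real.sqrt 3 / 3 * K0 t * PiA t / (A t) ^ 2) := by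
      linear_combination 6 * hsq t
    have hPP : 1 / 3 * N t * A t * P0 t * P0 t = 1 / 3 * N t * A t * (P0 t) ^ 2 := by ring
    rw [hPP, hP]
    field_simp
    ring
end
end

section
/- If differentiable functions K₊, 𝔭₊ : ℝ → ℝ satisfy the reduced canonical equation K̇₊ = (√6(3k²−1)/(3(1+k²)))K₊² − 𝔭₊/(1+k²) and the constraint 𝓗'(t) = 0 holds for all t, then K₊ obeys the binomial equation of Briot and Bouquet: K̇₊² = (2/3)(1+k²)K₊⁴ − (√6/3)(Π₊ + kΠ₋)K₊/(1+k²). -/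
noncomputable section

/-- **Reduced conformal Bianchi-type I system under `K₋ = kK₊`:**
the reduced canonical equation for `K₊` together with the vanishing of the reduced
super-Hamiltonian imply the binomial equation of Briot and Bouquet. -/
theorem conformal_bianchiI_briot_bouquet
    (k PiP PiM : ℝ) (Kp Pp : ℝ → ℝ)
    (hPpdiff : Differentiable ℝ Pp)
    (hKp : ∀ t, HasDerivAt Kp
      (Real.sqrt 6 * (3 * k ^ 2 - 1) / (3 * (1 + k ^ 2)) * (Kp t) ^ 2
        - Pp t / (1 + k ^ 2)) t)
    (hcon : ∀ t,
      k ^ 2 * (k ^ 2 - 3) ^ 2 / (3 * (1 + k ^ 2)) * (Kp t) ^ 4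
        + Real.sqrt 6 * (3 * k ^ 2 - 1) / (3 * (1 + k ^ 2)) * (Kp t) ^ 2 * Pp t
        - Real.sqrt 6 / 6 * (PiP + k * PiM) * Kp t
        - (Pp t) ^ 2 / (2 * (1 + k ^ 2)) = 0) :
    ∀ t, (deriv Kp t) ^ 2 =
      2 / 3 * (1 + k ^ 2) * (Kp t) ^ 4
        - Real.sqrt 6 / 3 * (PiP + k * PiM) * Kp t / (1 + k ^ 2) := by
  intro t
  have hsq : Real.sqrt 6 ^ 2 = 6 := Real.sq_sqrt (by norm_num)
  have hk : (1 + k ^ 2 : ℝ) ≠ 0 := by positivity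
  have key : 2 / 3 * ((3 * k ^ 2 - 1) ^ 2 + k ^ 2 * (k ^ 2 - 3) ^ 2) / (1 + k ^ 2) ^ 2
      = 2 / 3 * (1 + k ^ 2) := by
    field_simp
    ring
  rw [(hKp t).deriv, ← key]
  linear_combination (norm := (field_simp; ring)) (-2 / (1 + k ^ 2)) * hcon t
    + ((3 * k ^ 2 - 1) ^ 2 / (9 * (1 + k ^ 2) ^ 2) * Kp t ^ 4) * hsq
end
end

section
/- With the stated definitions one has the identities Π₊ = 6β⃛₊ − 48β̇₊(β̇₊² + β̇₋²) and Π₋ = 6β⃛₋ − 48β̇₋(β̇₊² + β̇₋²), and the super-Hamiltonian of conformal gravity coincides (up to the factor 3) with the time–time component of the Bach tensor of the Bianchi-type I metric: H = 3 B₀₀. -/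
noncomputable section

/-- `K₊ := -√6 β̇₊`. -/
def mKp (βp : ℝ → ℝ) : ℝ → ℝ := fun t => -Real.sqrt 6 * deriv βp t

/-- `K₋ := -√6 β̇₋`. -/
def mKm (βm : ℝ → ℝ) : ℝ → ℝ := fun t => -Real.sqrt 6 * deriv βm t

/-- `𝔭₊ := (√6/3)(K₋² − K₊²) − K̇₊`. -/
def mPp (βp βm : ℝ → ℝ) : ℝ → ℝ := fun t =>
  Real.sqrt 6 / 3 * ((mKm βm t) ^ 2 - (mKp βp t) ^ 2) - deriv (mKp βp) t

/-- `𝔭₋ := (2√6/3)K₊K₋ − K̇₋`. -/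
def mPm (βp βm : ℝ → ℝ) : ℝ → ℝ := fun t =>
  2 * Real.sqrt 6 / 3 * (mKp βp t * mKm βm t) - deriv (mKm βm) t

/-- `Π₊ := √6 𝔭̇₊ + 4K₋𝔭₋ − 4K₊𝔭₊`. -/
def mPip (βp βm : ℝ → ℝ) : ℝ → ℝ := fun t =>
  Real.sqrt 6 * deriv (mPp βp βm) t + 4 * mKm βm t * mPm βp βm t
    - 4 * mKp βp t * mPp βp βm t

/-- `Π₋ := √6 𝔭̇₋ + 4K₋𝔭₊ + 4K₊𝔭₋`. -/
def mPim (βp βm : ℝ → ℝ) : ℝ → ℝ := fun t =>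
  Real.sqrt 6 * deriv (mPm βp βm) t + 4 * mKm βm t * mPp βp βm t
    + 4 * mKp βp t * mPm βp βm t

/-- The super-Hamiltonian of conformal gravity for Bianchi type I. -/
def mH (βp βm : ℝ → ℝ) : ℝ → ℝ := fun t =>
  Real.sqrt 6 / 6 *
      (4 * mPm βp βm t * mKp βp t * mKm βm t
        - 2 * mPp βp βm t * ((mKp βp t) ^ 2 - (mKm βm t) ^ 2)
        - mKp βp t * mPip βp βm t - mKm βm t * mPim βp βm t)
    - 1 / 2 * ((mPp βp βm t) ^ 2 + (mPm βp βm t) ^ 2)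

/-- Time–time component of the Bach tensor of the Bianchi-type I metric. -/
def mB00 (βp βm : ℝ → ℝ) : ℝ → ℝ := fun t =>
  2 * deriv (deriv (deriv βm)) t * deriv βm t - (deriv (deriv βm) t) ^ 2
    - 12 * (deriv βm t) ^ 4 - 24 * (deriv βm t) ^ 2 * (deriv βp t) ^ 2
    + 2 * deriv (deriv (deriv βp)) t * deriv βp t - (deriv (deriv βp) t) ^ 2
    - 12 * (deriv βp t) ^ 4

/-- `K₊` differentiates to `-√6 β̈₊`. -/
theorem deriv_mKp (βp : ℝ → ℝ) : deriv (mKp βp) = fun t => -Real.sqrt 6 * deriv (deriv βp) t := by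
  funext t
  exact deriv_const_mul_field (-Real.sqrt 6)

/-- `K₋` differentiates to `-√6 β̈₋`. -/
theorem deriv_mKm (βm : ℝ → ℝ) : deriv (mKm βm) = fun t => -Real.sqrt 6 * deriv (deriv βm) t :=
  deriv_mKp βm

theorem mPp_eq (βp βm : ℝ → ℝ) : mPp βp βm = fun t =>
    Real.sqrt 6 * (2 * ((deriv βm t) ^ 2 - (deriv βp t) ^ 2) + deriv (deriv βp) t) := by
  have h6 : Real.sqrt 6 ^ 2 = 6 := Real.sq_sqrt (by norm_num)
  funext t
  simp only [mPp, deriv_mKp, mKp, mKm]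
  linear_combination Real.sqrt 6 / 3 * ((deriv βm t) ^ 2 - (deriv βp t) ^ 2) * h6

theorem mPm_eq (βp βm : ℝ → ℝ) : mPm βp βm = fun t =>
    Real.sqrt 6 * (4 * (deriv βp t * deriv βm t) + deriv (deriv βm) t) := by
  have h6 : Real.sqrt 6 ^ 2 = 6 := Real.sq_sqrt (by norm_num)
  funext t
  simp only [mPm, deriv_mKm, mKp, mKm]
  linear_combination 2 * Real.sqrt 6 / 3 * (deriv βp t * deriv βm t) * h6

theorem deriv_mPp {βp βm : ℝ → ℝ} {t : ℝ} (hp : DifferentiableAt ℝ (deriv βp) t)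
    (hp' : DifferentiableAt ℝ (deriv (deriv βp)) t) (hm : DifferentiableAt ℝ (deriv βm) t) :
    deriv (mPp βp βm) t = Real.sqrt 6 *
      (4 * (deriv βm t * deriv (deriv βm) t - deriv βp t * deriv (deriv βp) t)
        + deriv (deriv (deriv βp)) t) := by
  rw [mPp_eq]
  refine HasDerivAt.deriv ?_
  refine (((((hm.hasDerivAt.pow 2).sub (hp.hasDerivAt.pow 2)).const_mul 2).add
    hp'.hasDerivAt).const_mul (Real.sqrt 6)).congr_deriv ?_
  push_cast
  ring

theorem deriv_mPm {βp βm : ℝ → ℝ} {t : ℝ} (hp : DifferentiableAt ℝ (deriv βp) t)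
    (hm : DifferentiableAt ℝ (deriv βm) t) (hm' : DifferentiableAt ℝ (deriv (deriv βm)) t) :
    deriv (mPm βp βm) t = Real.sqrt 6 *
      (4 * (deriv (deriv βp) t * deriv βm t + deriv βp t * deriv (deriv βm) t)
        + deriv (deriv (deriv βm)) t) :=
  ((((hp.hasDerivAt.mul hm.hasDerivAt).const_mul 4).add hm'.hasDerivAt).const_mul
    (Real.sqrt 6)).deriv ▸ congrArg (deriv · t) (mPm_eq βp βm)

/-- **The conformal-gravity super-Hamiltonian coincides with (3×) the time–time
component of the Bach tensor for Bianchi type I**, together with the explicit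
expressions of `Π±` in terms of the Misner anisotropy variables. -/
theorem conformal_H_eq_3B00
    (βp βm : ℝ → ℝ)
    (hβp1 : Differentiable ℝ βp) (hβp2 : Differentiable ℝ (deriv βp))
    (hβp3 : Differentiable ℝ (deriv (deriv βp)))
    (hβp4 : Differentiable ℝ (deriv (deriv (deriv βp))))
    (hβm1 : Differentiable ℝ βm) (hβm2 : Differentiable ℝ (deriv βm))
    (hβm3 : Differentiable ℝ (deriv (deriv βm)))
    (hβm4 : Differentiable ℝ (deriv (deriv (deriv βm)))) :
    (∀ t, mPip βp βm t =
      6 * deriv (deriv (deriv βp)) t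
        - 48 * deriv βp t * ((deriv βp t) ^ 2 + (deriv βm t) ^ 2)) ∧
    (∀ t, mPim βp βm t =
      6 * deriv (deriv (deriv βm)) t
        - 48 * deriv βm t * ((deriv βp t) ^ 2 + (deriv βm t) ^ 2)) ∧
    (∀ t, mH βp βm t = 3 * mB00 βp βm t) := by
  have h6 : Real.sqrt 6 ^ 2 = 6 := Real.sq_sqrt (by norm_num)
  have hPip : ∀ t, mPip βp βm t =
      6 * deriv (deriv (deriv βp)) t
        - 48 * deriv βp t * ((deriv βp t) ^ 2 + (deriv βm t) ^ 2) := by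
    intro t
    simp only [mPip, deriv_mPp (hβp2 t) (hβp3 t) (hβm2 t)]
    simp only [mPp_eq, mPm_eq, mKp, mKm]
    ring_nf
    simp only [h6]
    ring
  have hPim : ∀ t, mPim βp βm t =
      6 * deriv (deriv (deriv βm)) t
        - 48 * deriv βm t * ((deriv βp t) ^ 2 + (deriv βm t) ^ 2) := by
    intro t
    simp only [mPim, deriv_mPm (hβp2 t) (hβm2 t) (hβm3 t)]
    simp only [mPp_eq, mPm_eq, mKp, mKm]
    ring_nf
    simp only [h6]
    ring
  refine ⟨hPip, hPim, fun t => ?_⟩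
  have h4 : Real.sqrt 6 ^ 4 = 36 := by
    rw [show Real.sqrt 6 ^ 4 = (Real.sqrt 6 ^ 2) ^ 2 by ring, h6]
    norm_num
  simp only [mH, hPip, hPim, mPp_eq, mPm_eq, mKp, mKm, mB00]
  ring_nf
  simp only [h6, h4]
  ring
end
end

section
/- For any real constants K, t₀ and any sign ε ∈ {+1, −1}, the functions defined on the interval t > t₀ (with χ := t − t₀) by K₊(t) := ε(√6/2) sin(4K)/χ, K₋(t) := (√6/2) cos(4K)/χ, 𝔭₊(t) := (√6/2)(1 + ε sin(4K) − 2 sin²(4K))/χ², 𝔭₋(t) := (√6/2) cos(4K)(1 + 2ε sin(4K))/χ² form an exact two-parameter solution of the conformal Bianchi-type I canonical system with Π± = 0, and they satisfy the super-Hamiltonian constraint 𝓗(t) = 0 for all t > t₀. -/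
noncomputable section

/-- `K₊(t) := ε(√6/2) sin(4K)/(t − t₀)`. -/
def sKp (Kc t₀ ε : ℝ) : ℝ → ℝ := fun t =>
  ε * (Real.sqrt 6 / 2) * Real.sin (4 * Kc) / (t - t₀)

/-- `K₋(t) := (√6/2) cos(4K)/(t − t₀)`. -/
def sKm (Kc t₀ : ℝ) : ℝ → ℝ := fun t =>
  Real.sqrt 6 / 2 * Real.cos (4 * Kc) / (t - t₀)

/-- `𝔭₊(t) := (√6/2)(1 + ε sin(4K) − 2 sin²(4K))/(t − t₀)²`. -/
def sPp (Kc t₀ ε : ℝ) : ℝ → ℝ := fun t =>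
  Real.sqrt 6 / 2 * (1 + ε * Real.sin (4 * Kc) - 2 * Real.sin (4 * Kc) ^ 2) / (t - t₀) ^ 2

/-- `𝔭₋(t) := (√6/2) cos(4K)(1 + 2ε sin(4K))/(t − t₀)²`. -/
def sPm (Kc t₀ ε : ℝ) : ℝ → ℝ := fun t =>
  Real.sqrt 6 / 2 * Real.cos (4 * Kc) * (1 + 2 * ε * Real.sin (4 * Kc)) / (t - t₀) ^ 2

theorem hasDerivAt_const_div_sub (A t₀ : ℝ) {t : ℝ} (ht : t ≠ t₀) :
    HasDerivAt (fun t => A / (t - t₀)) (-A * ((t - t₀)⁻¹) ^ 2) t := by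
  have hx : t - t₀ ≠ 0 := sub_ne_zero.mpr ht
  refine ((hasDerivAt_const t A).fun_div ((hasDerivAt_id' t).sub_const t₀) hx).congr_deriv ?_
  field_simp
  ring

theorem hasDerivAt_const_div_sub_sq (A t₀ : ℝ) {t : ℝ} (ht : t ≠ t₀) :
    HasDerivAt (fun t => A / (t - t₀) ^ 2) (-2 * A * ((t - t₀)⁻¹) ^ 3) t := by
  have hx : t - t₀ ≠ 0 := sub_ne_zero.mpr ht
  refine ((hasDerivAt_const t A).fun_div (((hasDerivAt_id' t).sub_const t₀).fun_pow 2)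
    (pow_ne_zero 2 hx)).congr_deriv ?_
  field_simp
  ring

/-- **Exact two-parameter solution of the conformal Bianchi-type I canonical system
with `Π± = 0`**, satisfying the super-Hamiltonian constraint on `t > t₀`. -/
theorem conformal_bianchiI_exact_solution
    (Kc t₀ ε : ℝ) (hε : ε = 1 ∨ ε = -1) :
    ∀ t, t₀ < t →
      HasDerivAt (sKp Kc t₀ ε)
        (Real.sqrt 6 / 3 * ((sKm Kc t₀ t) ^ 2 - (sKp Kc t₀ ε t) ^ 2) - sPp Kc t₀ ε t) t ∧
      HasDerivAt (sKm Kc t₀)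
        (2 * Real.sqrt 6 / 3 * (sKp Kc t₀ ε t * sKm Kc t₀ t) - sPm Kc t₀ ε t) t ∧
      HasDerivAt (sPp Kc t₀ ε)
        (2 * Real.sqrt 6 / 3 * (sKp Kc t₀ ε t * sPp Kc t₀ ε t - sKm Kc t₀ t * sPm Kc t₀ ε t)) t ∧
      HasDerivAt (sPm Kc t₀ ε)
        (-(2 * Real.sqrt 6 / 3) * (sKm Kc t₀ t * sPp Kc t₀ ε t + sKp Kc t₀ ε t * sPm Kc t₀ ε t)) t ∧
      Real.sqrt 6 / 3 *
          (2 * sPm Kc t₀ ε t * sKp Kc t₀ ε t * sKm Kc t₀ t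
            - sPp Kc t₀ ε t * ((sKp Kc t₀ ε t) ^ 2 - (sKm Kc t₀ t) ^ 2))
        - 1 / 2 * ((sPp Kc t₀ ε t) ^ 2 + (sPm Kc t₀ ε t) ^ 2) = 0 := by
  intro t ht
  have hne := ht.ne'
  have hr : Real.sqrt 6 ^ 2 = 6 := Real.sq_sqrt (by norm_num)
  have hc : Real.cos (4 * Kc) ^ 2 = 1 - Real.sin (4 * Kc) ^ 2 := Real.cos_sq' _
  have hε2 : ε ^ 2 = 1 := by rcases hε with rfl | rfl <;> norm_num
  refine ⟨(hasDerivAt_const_div_sub _ t₀ hne).congr_deriv ?_,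
    (hasDerivAt_const_div_sub _ t₀ hne).congr_deriv ?_,
    (hasDerivAt_const_div_sub_sq _ t₀ hne).congr_deriv ?_,
    (hasDerivAt_const_div_sub_sq _ t₀ hne).congr_deriv ?_, ?_⟩ <;>
  · simp only [sKp, sKm, sPp, sPm, div_eq_mul_inv _ (t - t₀), div_eq_mul_inv _ ((t - t₀) ^ 2),
      ← inv_pow]
    generalize (t - t₀)⁻¹ = x
    generalize Real.sqrt 6 = r at *
    generalize Real.sin (4 * Kc) = s at *
    generalize Real.cos (4 * Kc) = c at *
    clear hε
    grind
end
end
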